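/- Let f be a transcendental entire function with a multiply connected wandering domain U. Then there exist sequences (rₙ) and (Rₙ) of positive reals with rₙ → ∞ and Rₙ/rₙ → ∞ such that, for all sufficiently large n, {z : rₙ ≤ |z| ≤ Rₙ} ⊆ fⁿ(U) ⊆ {z : R_{n-1} ≤ |z| ≤ r_{n+1}}. -/

import Mathlib

open MeasureTheory Filter Metric Set Topology ENNReal

/-- Logarithmic area of a subset of the plane. -/
noncomputable def logArea (A : Set ℂ) : ℝ≥0∞ :=
  ∫⁻ z in A, ENNReal.ofReal ((‖z‖ ^ 2)⁻¹)

/-- The set Δ = {z : |z| ≥ 1}. -/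
def Delta : Set ℂ := {z : ℂ | 1 ≤ ‖z‖}

/-- Chordal (spherical) distance on the Riemann sphere ℂ ∪ {∞}, with ∞ encoded as `none`. -/
noncomputable def chordalDist : Option ℂ → Option ℂ → ℝ
  | none, none => 0
  | none, some w => 2 / Real.sqrt (1 + ‖w‖ ^ 2)
  | some z, none => 2 / Real.sqrt (1 + ‖z‖ ^ 2)
  | some z, some w =>
      2 * ‖z - w‖ / (Real.sqrt (1 + ‖z‖ ^ 2) * Real.sqrt (1 + ‖w‖ ^ 2))

/-- Locally uniform convergence on `U` of a sequence of ℂ-valued functions towards a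
function with values in the Riemann sphere, with respect to the spherical metric. -/
def SphLocUnifConvOn (F : ℕ → ℂ → ℂ) (g : ℂ → Option ℂ) (U : Set ℂ) : Prop :=
  ∀ K : Set ℂ, K ⊆ U → IsCompact K → ∀ ε : ℝ, 0 < ε →
    ∀ᶠ n in atTop, ∀ z ∈ K, chordalDist (some (F n z)) (g z) < ε

/-- The Fatou set: points having a neighborhood on which every sequence of iterates has a
subsequence converging locally uniformly with respect to the spherical metric. -/
def fatouSet (f : ℂ → ℂ) : Set ℂ :=
  {z | ∃ U ∈ 𝓝 z, ∀ φ : ℕ → ℕ, StrictMono φ →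
    ∃ ψ : ℕ → ℕ, StrictMono ψ ∧ ∃ g : ℂ → Option ℂ,
      SphLocUnifConvOn (fun n => f^[φ (ψ n)]) g U}

/-- The Julia set. -/
def juliaSet (f : ℂ → ℂ) : Set ℂ := (fatouSet f)ᶜ

/-- The escaping set. -/
def escapingSet (f : ℂ → ℂ) : Set ℂ :=
  {z | Tendsto (fun n => ‖f^[n] z‖) atTop atTop}

/-- The Fatou set has no multiply connected component. -/
def NoMultiplyConnectedFatouComponent (f : ℂ → ℂ) : Prop :=
  ∀ z ∈ fatouSet f, SimplyConnectedSpace (connectedComponentIn (fatouSet f) z)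

/-- Maximum modulus M(r,f). -/
noncomputable def maxMod (f : ℂ → ℂ) (r : ℝ) : ℝ :=
  sSup ((fun z => ‖f z‖) '' {z : ℂ | ‖z‖ = r})

/-- The order ρ(f) of an entire function, as an extended real number. -/
noncomputable def entireOrder (f : ℂ → ℂ) : EReal :=
  limsup (fun r : ℝ => ((Real.log (Real.log (maxMod f r)) / Real.log r : ℝ) : EReal)) atTop

/-- The fast escaping set A(f). -/
def fastEscapingSet (f : ℂ → ℂ) : Set ℂ :=
  {z | ∃ R : ℝ, 0 < R ∧ (∀ r : ℝ, R ≤ r → r < maxMod f r) ∧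
    ∃ L : ℕ, ∀ n : ℕ, L < n → (maxMod f)^[n - L] R ≤ ‖f^[n] z‖}

/-- `f` is a transcendental entire function. -/
def TranscendentalEntire (f : ℂ → ℂ) : Prop :=
  Differentiable ℂ f ∧ ¬ ∃ p : Polynomial ℂ, ∀ z, f z = p.eval z

/-- Order of vanishing of `g` at `z` (the least `k` with nonzero `k`-th derivative). -/
noncomputable def vanishingOrder (g : ℂ → ℂ) (z : ℂ) : ℕ :=
  sInf {k : ℕ | iteratedDeriv k g z ≠ 0}

/-- n(r,a): the number of solutions of f(z) = a with |z| ≤ r, counted with multiplicity. -/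
noncomputable def nCount (f : ℂ → ℂ) (a : ℂ) (r : ℝ) : ℕ :=
  ∑ᶠ z ∈ {z : ℂ | ‖z‖ ≤ r ∧ f z = a}, vanishingOrder (fun w => f w - a) z

/-- n(r) = max over a of n(r,a). -/
noncomputable def nMax (f : ℂ → ℂ) (r : ℝ) : ℕ := ⨆ a : ℂ, nCount f a r

/-- Critical values of `f`. -/
def criticalValues (f : ℂ → ℂ) : Set ℂ := {w | ∃ z, deriv f z = 0 ∧ f z = w}

/-- Finite asymptotic values of `f`. -/
def asymptoticValues (f : ℂ → ℂ) : Set ℂ :=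
  {w | ∃ γ : ℝ → ℂ, Continuous γ ∧ Tendsto (fun t => ‖γ t‖) atTop atTop ∧
    Tendsto (fun t => f (γ t)) atTop (𝓝 w)}

/-- The Eremenko–Lyubich class B. -/
def ELClass (f : ℂ → ℂ) : Prop :=
  TranscendentalEntire f ∧ Bornology.IsBounded (criticalValues f ∪ asymptoticValues f)

/-- Semihyperbolic polynomial. -/
def SemiHyperbolic (p : Polynomial ℂ) : Prop :=
  ∃ ε : ℝ, 0 < ε ∧ ∃ N : ℕ, ∀ z ∈ juliaSet (fun w => p.eval w), ∀ n : ℕ, 1 ≤ n →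
    ∀ V : Set ℂ, (∃ u ∈ (fun w => p.eval w)^[n] ⁻¹' ball z ε,
        V = connectedComponentIn ((fun w => p.eval w)^[n] ⁻¹' ball z ε) u) →
      ∀ w ∈ ball z ε,
        (∑ᶠ u ∈ {u : ℂ | u ∈ V ∧ (fun v => p.eval v)^[n] u = w},
          vanishingOrder (fun ζ => (fun v => p.eval v)^[n] ζ - w) u) ≤ N

/-- `U` is a multiply connected wandering domain of `f`. -/
def IsMultiplyConnectedWanderingDomain (f : ℂ → ℂ) (U : Set ℂ) : Prop :=
  (∃ z ∈ fatouSet f, U = connectedComponentIn (fatouSet f) z) ∧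
  (∀ m n : ℕ, m ≠ n → ∀ u ∈ U,
    connectedComponentIn (fatouSet f) (f^[m] u) ≠
      connectedComponentIn (fatouSet f) (f^[n] u)) ∧
  ¬ SimplyConnectedSpace U

theorem quotient_cast_eq_refl_of_conj {X : Type*} [TopologicalSpace X] {x : X}
    (τ : ∀ y : X, Path.Homotopic.Quotient x y) {u v : X} (hu : u = x) (hv : v = x)
    (g : Path.Homotopic.Quotient u v)
    (h : ((τ u).trans g).trans (τ v).symm = Path.Homotopic.Quotient.refl x) :
    g.cast hu.symm hv.symm = Path.Homotopic.Quotient.refl x := by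
  subst hu
  subst hv
  have h2 : g = ((τ v).symm.trans (((τ v).trans g).trans (τ v).symm)).trans (τ v) := by
    rw [Path.Homotopic.Quotient.trans_assoc, Path.Homotopic.Quotient.trans_assoc,
      Path.Homotopic.Quotient.trans_assoc]
    simp [← Path.Homotopic.Quotient.trans_assoc]
  rw [Path.Homotopic.Quotient.cast_rfl_rfl, h2, h]
  simp

theorem homotopic_of_mem_convex {U C : Set ℂ} (hC : Convex ℝ C) (hCU : C ⊆ U) {x y : U}
    (p q : Path x y) (hp : ∀ t, (p t : ℂ) ∈ C) (hq : ∀ t, (q t : ℂ) ∈ C) : p.Homotopic q := by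
  have hx : (x : ℂ) ∈ C := by simpa using hp 0
  have hy : (y : ℂ) ∈ C := by simpa using hp 1
  have : ContractibleSpace C := hC.contractibleSpace ⟨x, hx⟩
  let lift (r : Path x y) (hr : ∀ t, (r t : ℂ) ∈ C) : Path (⟨x, hx⟩ : C) ⟨y, hy⟩ :=
    { toFun := fun t => ⟨r t, hr t⟩
      continuous_toFun := by fun_prop
      source' := by simp
      target' := by simp }
  have h := (SimplyConnectedSpace.paths_homotopic (lift p hp) (lift q hq)).map
    (⟨Set.inclusion hCU, continuous_inclusion hCU⟩ : C(C, U))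
  exact h

/-- The straight path between two points of a convex subset of `U`. -/
theorem exists_path_mem_convex {U C : Set ℂ} (hC : Convex ℝ C) (hCU : C ⊆ U) {x y : U}
    (hx : (x : ℂ) ∈ C) (hy : (y : ℂ) ∈ C) : ∃ p : Path x y, ∀ t, (p t : ℂ) ∈ C := by
  have : ContractibleSpace C := hC.contractibleSpace ⟨x, hx⟩
  let p : Path (⟨x, hx⟩ : C) ⟨y, hy⟩ := PathConnectedSpace.somePath _ _
  exact ⟨p.map (continuous_inclusion hCU), fun t => (p t).2⟩

open Path.Homotopic in
theorem exists_edge_cocycle {U : Set ℂ} [PathConnectedSpace U] {x : U} (γ : Path x x) :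
    ∃ (G : Type) (_ : Group G) (e : ℂ → ℂ → G) (E : unitInterval → unitInterval → G),
      (∀ C ⊆ U, Convex ℝ C → ∀ a ∈ C, ∀ b ∈ C, ∀ c ∈ C, e b c * e a b = e a c) ∧
      (∀ s t r, E t r * E s t = E s r) ∧
      (∀ C ⊆ U, Convex ℝ C → ∀ s t, (∀ r ∈ uIcc s t, (γ r : ℂ) ∈ C) →
        E s t = e (γ s) (γ t)) ∧
      (E 0 1 = 1 → γ.Homotopic (Path.refl x)) := by
  classical
  let τ : ∀ y : U, Path.Homotopic.Quotient x y := fun y => .mk (PathConnectedSpace.somePath x y)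
  let P : ℂ → ℂ → Prop := fun a b => ∃ C ⊆ U, Convex ℝ C ∧ a ∈ C ∧ b ∈ C
  have hP : ∀ a b, P a b → ∃ g : FundamentalGroup U x, ∀ C, Convex ℝ C → ∀ hC : C ⊆ U,
      ∀ (ha : a ∈ C) (hb : b ∈ C) (p : Path (⟨a, hC ha⟩ : U) ⟨b, hC hb⟩), (∀ t, (p t : ℂ) ∈ C) →
      g = ((τ _).trans (.mk p : Path.Homotopic.Quotient _ _)).trans (τ _).symm := by
    rintro a b ⟨C, hCU, hC, ha, hb⟩
    obtain ⟨p, hp⟩ := exists_path_mem_convex hC hCU (x := ⟨a, hCU ha⟩) (y := ⟨b, hCU hb⟩) ha hb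
    refine ⟨((τ _).trans (.mk p : Path.Homotopic.Quotient _ _)).trans (τ _).symm, ?_⟩
    intro C' hC' hCU' ha' hb' q hq
    obtain ⟨r, hr⟩ := exists_path_mem_convex (hC.inter hC') (inter_subset_left.trans hCU)
      (x := ⟨a, hCU ha⟩) (y := ⟨b, hCU hb⟩) ⟨ha, ha'⟩ ⟨hb, hb'⟩
    have h1 : p.Homotopic r := homotopic_of_mem_convex hC hCU _ _ hp (fun t => (hr t).1)
    have h2 : q.Homotopic r := homotopic_of_mem_convex hC' hCU' _ _ hq (fun t => (hr t).2)
    have h3 : (.mk p : Path.Homotopic.Quotient _ _) = (.mk q) := _root_.Quotient.sound (h1.trans h2.symm)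
    rw [h3]
  choose g hg using hP
  let e : ℂ → ℂ → FundamentalGroup U x := fun a b => if h : P a b then g a b h else 1
  have he : ∀ a b C, Convex ℝ C → ∀ hC : C ⊆ U,
      ∀ (ha : a ∈ C) (hb : b ∈ C) (p : Path (⟨a, hC ha⟩ : U) ⟨b, hC hb⟩), (∀ t, (p t : ℂ) ∈ C) →
      e a b = ((τ _).trans (.mk p : Path.Homotopic.Quotient _ _)).trans (τ _).symm := by
    intro a b C hC hCU ha hb p hp
    have h : P a b := ⟨C, hCU, hC, ha, hb⟩
    simp only [e, dif_pos h]
    exact hg a b h C hC hCU ha hb p hp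
  let E : unitInterval → unitInterval → FundamentalGroup U x := fun s t =>
    ((τ (γ s)).trans (.mk (γ.subpath s t) : Path.Homotopic.Quotient _ _)).trans (τ (γ t)).symm
  have key : ∀ {a b c : U} (p : Path.Homotopic.Quotient a b) (q : Path.Homotopic.Quotient b c),
      (((τ a).trans p).trans (τ b).symm).trans (((τ b).trans q).trans (τ c).symm) =
      ((τ a).trans (p.trans q)).trans (τ c).symm := by
    intro a b c p q
    have : (τ b).symm.trans ((τ b).trans (q.trans (τ c).symm)) = q.trans (τ c).symm := by
      rw [← Path.Homotopic.Quotient.trans_assoc]; simp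
    simp only [Path.Homotopic.Quotient.trans_assoc]
    rw [this]
  refine ⟨FundamentalGroup U x, inferInstance, e, E, ?_, ?_, ?_, ?_⟩
  · intro C hCU hC a ha b hb c hc
    obtain ⟨p, hp⟩ := exists_path_mem_convex hC hCU (x := ⟨a, hCU ha⟩) (y := ⟨b, hCU hb⟩) ha hb
    obtain ⟨q, hq⟩ := exists_path_mem_convex hC hCU (x := ⟨b, hCU hb⟩) (y := ⟨c, hCU hc⟩) hb hc
    have hpq : ∀ t, ((p.trans q) t : ℂ) ∈ C := by
      intro t
      have : (p.trans q) t ∈ range (p.trans q) := mem_range_self t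
      rw [Path.trans_range] at this
      rcases this with ⟨s, hs⟩ | ⟨s, hs⟩
      · rw [← hs]; exact hp s
      · rw [← hs]; exact hq s
    rw [he a b C hC hCU ha hb p hp, he b c C hC hCU hb hc q hq,
      he a c C hC hCU ha hc (p.trans q) hpq]
    exact key _ _
  · intro s t r
    refine (key _ _).trans ?_
    have : Path.Homotopic.Quotient.trans (.mk (γ.subpath s t) : Path.Homotopic.Quotient _ _)
        (.mk (γ.subpath t r) : Path.Homotopic.Quotient _ _) =
        (.mk (γ.subpath s r) : Path.Homotopic.Quotient _ _) :=
      _root_.Quotient.sound ⟨Path.Homotopy.subpathTransSubpath γ s t r⟩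
    simp only [E]
    rw [this]
  · intro C hCU hC s t h
    refine (he _ _ C hC hCU (h s left_mem_uIcc) (h t right_mem_uIcc) (γ.subpath s t) ?_).symm
    intro r
    have : γ.subpath s t r ∈ range (γ.subpath s t) := mem_range_self r
    rw [Path.range_subpath] at this
    obtain ⟨r', hr', h'⟩ := this
    rw [← h']
    exact h r' hr'
  · intro h
    have h1 := quotient_cast_eq_refl_of_conj τ γ.source γ.target
      (.mk (γ.subpath 0 1) : Path.Homotopic.Quotient _ _) h
    rw [Path.subpath_zero_one] at h1
    exact _root_.Quotient.exact h1

/-- The point of the plane attached to a vertex of the integer grid. -/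
noncomputable def gridPoint (v : ℕ × ℕ) : ℂ := ⟨v.1, v.2⟩

/-- Adjacency in the integer grid. -/
def GridAdj (v w : ℕ × ℕ) : Prop :=
  (v.1 = w.1 ∧ (v.2 = w.2 + 1 ∨ w.2 = v.2 + 1)) ∨ (v.2 = w.2 ∧ (v.1 = w.1 + 1 ∨ w.1 = v.1 + 1))

/-- The graph of the edges of the integer grid which are contained in `U`. -/
def gridGraph (U : Set ℂ) : SimpleGraph (ℕ × ℕ) where
  Adj v w := GridAdj v w ∧ segment ℝ (gridPoint v) (gridPoint w) ⊆ U
  symm := ⟨fun v w h => ⟨by unfold GridAdj at *; omega, by rw [segment_symm]; exact h.2⟩⟩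
  loopless := ⟨fun v h => by have := h.1; unfold GridAdj at this; omega⟩

namespace gridGraph

variable {U : Set ℂ}

/-- The change of the logarithm of `z - q` along a walk. -/
noncomputable def wind {v w : ℕ × ℕ} (p : (gridGraph U).Walk v w) (q : ℂ) : ℂ :=
  (p.darts.map fun d => Complex.log ((gridPoint d.snd - q) / (gridPoint d.fst - q))).sum

/-- The union of the edges of a walk. -/
def trace {v w : ℕ × ℕ} (p : (gridGraph U).Walk v w) : Set ℂ :=
  ⋃ d ∈ p.darts, segment ℝ (gridPoint d.fst) (gridPoint d.snd)

theorem trace_subset {v w : ℕ × ℕ} (p : (gridGraph U).Walk v w) : trace p ⊆ U :=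
  iUnion₂_subset fun d _ => d.adj.2

theorem isClosed_segment (x y : ℂ) : IsClosed (segment ℝ x y) := by
  rw [segment_eq_image_lineMap]
  exact (isCompact_Icc.image (AffineMap.lineMap_continuous)).isClosed

theorem isClosed_trace {v w : ℕ × ℕ} (p : (gridGraph U).Walk v w) : IsClosed (trace p) := by
  have : trace p = ⋃ d ∈ (p.darts.toFinset : Set (gridGraph U).Dart),
      segment ℝ (gridPoint d.fst) (gridPoint d.snd) := by
    simp [trace]
  rw [this]
  exact (Finset.finite_toSet _).isClosed_biUnion fun d _ => isClosed_segment _ _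

theorem div_mem_slitPlane {x y q : ℂ} (h : q ∉ segment ℝ x y) :
    (y - q) / (x - q) ∈ Complex.slitPlane := by
  by_contra hc
  apply h
  have hx : x - q ≠ 0 := by
    intro h0
    rw [sub_eq_zero] at h0
    exact h (h0 ▸ left_mem_segment ℝ x y)
  rw [Complex.mem_slitPlane_iff_not_le_zero, not_not] at hc
  obtain ⟨t, ht, ht'⟩ : ∃ t : ℝ, 0 ≤ t ∧ (y - q) / (x - q) = -(t : ℂ) := by
    rw [Complex.le_def] at hc
    refine ⟨-((y - q) / (x - q)).re, by simpa using hc.1, ?_⟩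
    apply Complex.ext
    · simp
    · simpa using hc.2
  have h1 : (1 + t : ℝ) ≠ 0 := by positivity
  have h1' : (1 + t : ℂ) ≠ 0 := by exact_mod_cast h1
  refine ⟨t / (1 + t), 1 / (1 + t), by positivity, by positivity, by field_simp; ring, ?_⟩
  rw [div_eq_iff hx] at ht'
  simp only [Complex.real_smul]
  push_cast
  field_simp
  linear_combination ht'

theorem exp_wind {v w : ℕ × ℕ} (p : (gridGraph U).Walk v w) {q : ℂ} (hv : gridPoint v ≠ q)
    (hq : q ∉ trace p) :
    Complex.exp (wind p q) = (gridPoint w - q) / (gridPoint v - q) := by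
  induction p with
  | nil => simp [wind, div_self (sub_ne_zero.2 hv)]
  | @cons u v w h p ih =>
    have h1 : q ∉ trace p := fun hc => hq (by simp only [trace] at hc ⊢; simp at hc ⊢; tauto)
    have h2 : q ∉ segment ℝ (gridPoint u) (gridPoint v) :=
      fun hc => hq (by simp only [trace]; simp; tauto)
    have h3 : gridPoint v ≠ q := fun hc => h2 (hc ▸ right_mem_segment ℝ _ _)
    have h4 : (gridPoint v - q) / (gridPoint u - q) ≠ 0 :=
      div_ne_zero (sub_ne_zero.2 h3) (sub_ne_zero.2 hv)
    have : wind (.cons h p) q =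
      Complex.log ((gridPoint v - q) / (gridPoint u - q)) + wind p q := by simp [wind]
    rw [this, Complex.exp_add, ih h3 h1, Complex.exp_log h4]
    have h5 := sub_ne_zero.2 h3
    have h6 := sub_ne_zero.2 hv
    field_simp

theorem continuousOn_wind {v w : ℕ × ℕ} (p : (gridGraph U).Walk v w) :
    ContinuousOn (wind p) (trace p)ᶜ := by
  induction p with
  | nil => exact (continuousOn_const (c := (0 : ℂ))).congr fun q _ => by simp [wind]
  | @cons u v w h p ih =>
    have h0 : (trace (.cons h p))ᶜ = (segment ℝ (gridPoint u) (gridPoint v))ᶜ ∩ (trace p)ᶜ := by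
      simp [trace]
    have : wind (.cons h p) = fun q =>
      Complex.log ((gridPoint v - q) / (gridPoint u - q)) + wind p q := by ext; simp [wind]
    rw [this, h0]
    refine ContinuousOn.add ?_ (ih.mono inter_subset_right)
    refine ContinuousOn.clog ?_ fun q hq => div_mem_slitPlane hq.1
    refine ContinuousOn.div (by fun_prop) (by fun_prop) fun q hq => ?_
    intro hc
    exact hq.1 ((sub_eq_zero.1 hc) ▸ left_mem_segment ℝ _ _)

theorem tendsto_wind {v w : ℕ × ℕ} (p : (gridGraph U).Walk v w) :
    Tendsto (wind p) (Bornology.cobounded ℂ) (𝓝 0) := by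
  induction p with
  | nil => exact tendsto_const_nhds.congr fun q => by simp [wind]
  | @cons u v w h p ih =>
    have : wind (.cons h p) = fun q =>
      Complex.log ((gridPoint v - q) / (gridPoint u - q)) + wind p q := by ext; simp [wind]
    rw [this, ← add_zero (0 : ℂ)]
    refine Tendsto.add ?_ ih
    rw [← Complex.log_one]
    refine Tendsto.clog ?_ (by simp)
    have h1 : Tendsto (fun q : ℂ => 1 + (gridPoint v - gridPoint u) * (gridPoint u - q)⁻¹)
        (Bornology.cobounded ℂ) (𝓝 (1 + (gridPoint v - gridPoint u) * 0)) := by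
      refine tendsto_const_nhds.add (tendsto_const_nhds.mul ?_)
      refine tendsto_inv₀_cobounded.comp ?_
      exact tendsto_const_sub_cobounded _
    simp only [mul_zero, add_zero] at h1
    refine h1.congr' ?_
    have h2 : ∀ᶠ q in Bornology.cobounded ℂ, q ≠ gridPoint u := by
      exact Bornology.isBounded_def.1 (Bornology.isBounded_singleton (x := gridPoint u))
    filter_upwards [h2] with q hq
    have := sub_ne_zero.2 hq.symm
    field_simp
    ring

theorem eq_zero_of_exp_eq_one {z : ℂ} (h : Complex.exp z = 1) (hz : ‖z‖ < 2 * Real.pi) :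
    z = 0 := by
  obtain ⟨n, rfl⟩ := Complex.exp_eq_one_iff.1 h
  have : ‖(n : ℂ) * (2 * Real.pi * Complex.I)‖ = |(n : ℝ)| * (2 * Real.pi) := by
    simp [abs_of_pos Real.pi_pos]
  rw [this] at hz
  have h1 : |(n : ℝ)| < 1 := by
    have := Real.pi_pos
    by_contra hc
    nlinarith
  have h2 : n = 0 := by
    rw [← Int.abs_lt_one_iff]; exact_mod_cast h1
  simp [h2]

theorem gridPoint_mem_trace {v : ℕ × ℕ} (p : (gridGraph U).Walk v v) (hp : ¬ p.Nil) :
    gridPoint v ∈ trace p := by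
  cases p with
  | nil => simp at hp
  | cons h p => simp [trace]; left; exact left_mem_segment ℝ _ _

/-- If all holes of `U` are filled, a closed walk in `U` does not wind around points off `U`. -/
theorem mem_of_wind_ne_zero
    (hole : ∀ D : Set ℂ, IsOpen D → Bornology.IsBounded D → frontier D ⊆ U → D ⊆ U)
    {v : ℕ × ℕ} (p : (gridGraph U).Walk v v) (hp : ¬ p.Nil) {S : Set ℂ}
    (hS : ∀ q ∈ S, q ∉ trace p ∧ wind p q ≠ 0) : closure S ⊆ U := by
  let D : Set ℂ := {q | q ∉ trace p ∧ wind p q ≠ 0}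
  have hexp : ∀ q, q ∉ trace p → Complex.exp (wind p q) = 1 := by
    intro q hq
    have hv : gridPoint v ≠ q := fun hc => hq (hc ▸ gridPoint_mem_trace p hp)
    rw [exp_wind p hv hq, div_self (sub_ne_zero.2 hv)]
  have hop : IsOpen (trace p)ᶜ := (isClosed_trace p).isOpen_compl
  have hD : IsOpen D := by
    have := (continuousOn_wind p).isOpen_inter_preimage hop (isOpen_compl_singleton (x := (0 : ℂ)))
    exact this
  have hD0 : IsOpen ((trace p)ᶜ ∩ wind p ⁻¹' ball 0 (2 * Real.pi)) :=
    (continuousOn_wind p).isOpen_inter_preimage hop isOpen_ball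
  have hfr : frontier D ⊆ trace p := by
    intro q hq
    by_contra hc
    rw [hD.frontier_eq] at hq
    have h0 : wind p q = 0 := by
      by_contra h; exact hq.2 ⟨hc, h⟩
    obtain ⟨q', hq', hq''⟩ := mem_closure_iff.1 hq.1 _ hD0 ⟨hc, by simp [h0, Real.pi_pos]⟩
    exact hq''.2 (eq_zero_of_exp_eq_one (hexp _ hq''.1) (by simpa using hq'.2))
  have hb : Bornology.IsBounded D := by
    rw [Bornology.isBounded_def]
    filter_upwards [(tendsto_wind p).eventually (ball_mem_nhds 0 Real.two_pi_pos)] with q hq hq'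
    exact hq'.2 (eq_zero_of_exp_eq_one (hexp _ hq'.1) (by simpa using hq))
  have hDU : D ⊆ U := hole D hD hb (hfr.trans (trace_subset p))
  have : closure D ⊆ U := by
    rw [closure_eq_self_union_frontier]
    exact union_subset hDU (hfr.trans (trace_subset p))
  exact (closure_mono (fun q hq => hS q hq)).trans this

end gridGraph

namespace gridGraph

variable {U : Set ℂ}

theorem sum_darts_eq_sub {v w : ℕ × ℕ} (p : (gridGraph U).Walk v w) {q : ℂ} (l : ℕ × ℕ → ℂ)
    (h : ∀ d ∈ p.darts, Complex.log ((gridPoint d.snd - q) / (gridPoint d.fst - q)) =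
      l d.snd - l d.fst) : wind p q = l w - l v := by
  induction p with
  | nil => simp [wind]
  | @cons u v w ha p ih =>
    have : wind (.cons ha p) q =
      Complex.log ((gridPoint v - q) / (gridPoint u - q)) + wind p q := by simp [wind]
    rw [this, ih fun d hd => h d (by simp [hd]), h ⟨(u, v), ha⟩ (by simp)]
    ring

theorem log_div_eq_sub {x y : ℂ} (hx : x ≠ 0) (hy : y ≠ 0)
    (h : x.arg - y.arg ∈ Ioc (-Real.pi) Real.pi) :
    Complex.log (x / y) = Complex.log x - Complex.log y := by
  rw [← Complex.exp_log hx, ← Complex.exp_log hy, ← Complex.exp_sub, Complex.log_exp]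
  · rw [Complex.exp_log hx, Complex.exp_log hy]
  · simpa [Complex.log_im] using h.1
  · simpa [Complex.log_im] using h.2

theorem gridPoint_re (v : ℕ × ℕ) : (gridPoint v).re = v.1 := rfl
theorem gridPoint_im (v : ℕ × ℕ) : (gridPoint v).im = v.2 := rfl

/-- For an edge avoiding the upward ray from `q`, the branch of the argument cut along this ray
computes the winding of the edge. -/
theorem log_edge {q : ℂ} {w x y : ℕ × ℕ} (h1 : q.re < w.1 + 1) (h1' : (w.1 : ℝ) < q.re)
    (h2' : (w.2 : ℝ) < q.im)
    (h : (x.2 ≤ w.2 ∧ y.2 ≤ w.2) ∨ (x.1 ≤ w.1 ∧ y.1 ≤ w.1) ∨ (w.1 < x.1 ∧ w.1 < y.1)) :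
    Complex.log ((gridPoint y - q) / (gridPoint x - q)) =
      Complex.log (Complex.I * (gridPoint y - q)) - Complex.log (Complex.I * (gridPoint x - q)) := by
  have hx : gridPoint x - q ≠ 0 := by
    intro hc
    have := congrArg Complex.re hc
    simp only [Complex.sub_re, gridPoint_re, Complex.zero_re] at this
    have a1 : (w.1 : ℝ) < x.1 := by linarith
    have a2 : (x.1 : ℝ) < w.1 + 1 := by linarith
    norm_cast at a1 a2; omega
  have hy : gridPoint y - q ≠ 0 := by
    intro hc
    have := congrArg Complex.re hc
    simp only [Complex.sub_re, gridPoint_re, Complex.zero_re] at this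
    have a1 : (w.1 : ℝ) < y.1 := by linarith
    have a2 : (y.1 : ℝ) < w.1 + 1 := by linarith
    norm_cast at a1 a2; omega
  rw [← log_div_eq_sub (mul_ne_zero Complex.I_ne_zero hy) (mul_ne_zero Complex.I_ne_zero hx),
    mul_div_mul_left _ _ Complex.I_ne_zero]
  have re (z : ℂ) : (Complex.I * z).re = -z.im := by simp
  have im (z : ℂ) : (Complex.I * z).im = z.re := by simp
  rcases h with h | h | h
  · have c1 : (x.2 : ℝ) ≤ w.2 := by exact_mod_cast h.1
    have c2 : (y.2 : ℝ) ≤ w.2 := by exact_mod_cast h.2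
    have a1 := Complex.abs_arg_lt_pi_div_two_iff (z := Complex.I * (gridPoint x - q)) |>.2
      (Or.inl (by rw [re, Complex.sub_im, gridPoint_im]; linarith))
    have a2 := Complex.abs_arg_lt_pi_div_two_iff (z := Complex.I * (gridPoint y - q)) |>.2
      (Or.inl (by rw [re, Complex.sub_im, gridPoint_im]; linarith))
    rw [abs_lt] at a1 a2
    constructor <;> linarith
  · have c1 : (x.1 : ℝ) ≤ w.1 := by exact_mod_cast h.1
    have c2 : (y.1 : ℝ) ≤ w.1 := by exact_mod_cast h.2
    have a1 := Complex.arg_neg_iff (z := Complex.I * (gridPoint x - q)) |>.2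
      (by rw [im, Complex.sub_re, gridPoint_re]; linarith)
    have a2 := Complex.arg_neg_iff (z := Complex.I * (gridPoint y - q)) |>.2
      (by rw [im, Complex.sub_re, gridPoint_re]; linarith)
    have a3 := Complex.neg_pi_lt_arg (Complex.I * (gridPoint x - q))
    have a4 := Complex.neg_pi_lt_arg (Complex.I * (gridPoint y - q))
    constructor <;> linarith
  · have c1 : (w.1 : ℝ) + 1 ≤ x.1 := by exact_mod_cast h.1
    have c2 : (w.1 : ℝ) + 1 ≤ y.1 := by exact_mod_cast h.2
    have a1 := Complex.arg_nonneg_iff (z := Complex.I * (gridPoint x - q)) |>.2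
      (by rw [im, Complex.sub_re, gridPoint_re]; linarith)
    have a2 := Complex.arg_nonneg_iff (z := Complex.I * (gridPoint y - q)) |>.2
      (by rw [im, Complex.sub_re, gridPoint_re]; linarith)
    have a3 : Complex.arg (Complex.I * (gridPoint x - q)) < Real.pi := by
      refine lt_of_le_of_ne (Complex.arg_le_pi _) fun hc => ?_
      have := (Complex.arg_eq_pi_iff.1 hc).2
      rw [im, Complex.sub_re, gridPoint_re] at this; linarith
    have a4 := Complex.arg_le_pi (Complex.I * (gridPoint y - q))
    constructor <;> linarith

theorem notMem_trace {q : ℂ} {m k : ℕ} (h1 : q.re < m + 1) (h1' : (m : ℝ) < q.re)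
    (h2 : q.im < k + 1) (h2' : (k : ℝ) < q.im) {v w : ℕ × ℕ} (p : (gridGraph U).Walk v w) :
    q ∉ trace p := by
  intro hq
  simp only [trace, mem_iUnion] at hq
  obtain ⟨d, hd, a, b, ha, hb, hab, rfl⟩ := hq
  obtain ⟨⟨x, y⟩, hadj⟩ := d
  have hadj' := hadj.1
  simp only [Complex.add_re, Complex.add_im, Complex.real_smul, Complex.mul_re, Complex.mul_im,
    Complex.ofReal_re, Complex.ofReal_im, gridPoint_re, gridPoint_im, zero_mul, sub_zero,
    add_zero] at h1 h1' h2 h2'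
  rcases hadj' with ⟨h, -⟩ | ⟨h, -⟩
  · rw [← h, ← add_mul, hab, one_mul] at h1 h1'
    norm_cast at h1 h1'; omega
  · rw [← h, ← add_mul, hab, one_mul] at h2 h2'
    norm_cast at h2 h2'; omega

/-- The winding of the top edge of a square around its points. -/
theorem top_edge_im {q : ℂ} {m k : ℕ} (h1 : q.re < m + 1) (h1' : (m : ℝ) < q.re)
    (h2 : q.im < k + 1) :
    Real.pi < (Complex.log (Complex.I * (gridPoint (m + 1, k + 1) - q)) -
      Complex.log (Complex.I * (gridPoint (m, k + 1) - q))).im := by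
  have re (z : ℂ) : (Complex.I * z).re = -z.im := by simp
  have im (z : ℂ) : (Complex.I * z).im = z.re := by simp
  rw [Complex.sub_im, Complex.log_im, Complex.log_im]
  have a1 : Real.pi / 2 < (Complex.I * (gridPoint (m + 1, k + 1) - q)).arg := by
    by_contra hc
    push Not at hc
    rw [Complex.arg_le_pi_div_two_iff, re, im, Complex.sub_re, Complex.sub_im, gridPoint_im,
      gridPoint_re] at hc
    push_cast at hc
    rcases hc with hc | hc <;> linarith
  have a2 : (Complex.I * (gridPoint (m, k + 1) - q)).arg < -(Real.pi / 2) := by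
    by_contra hc
    push Not at hc
    rw [Complex.neg_pi_div_two_le_arg_iff, re, im, Complex.sub_re, Complex.sub_im, gridPoint_im,
      gridPoint_re] at hc
    push_cast at hc
    rcases hc with hc | hc <;> linarith
  linarith

/-- The corner square of a closed walk without self intersection at its extremal vertex. -/
theorem square_subset
    (hole : ∀ D : Set ℂ, IsOpen D → Bornology.IsBounded D → frontier D ⊆ U → D ⊆ U)
    {m k : ℕ} {u u' : ℕ × ℕ} (hu : (gridGraph U).Adj (m + 1, k + 1) u)
    (hu' : (gridGraph U).Adj u' (m + 1, k + 1)) (p : (gridGraph U).Walk u u')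
    (hp : (m + 1, k + 1) ∉ p.support) (hmax : ∀ x ∈ p.support, x.2 ≤ k + 1 ∧
      (x.2 = k + 1 → x.1 ≤ m + 1))
    (huu : (u = (m, k + 1) ∧ u' = (m + 1, k)) ∨ (u = (m + 1, k) ∧ u' = (m, k + 1))) :
    Icc (m : ℝ) (m + 1) ×ℂ Icc (k : ℝ) (k + 1) ⊆ U := by
  have hcl : Icc (m : ℝ) (m + 1) ×ℂ Icc (k : ℝ) (k + 1) =
      closure (Ioo (m : ℝ) (m + 1) ×ℂ Ioo (k : ℝ) (k + 1)) := by
    rw [Complex.closure_reProdIm, closure_Ioo (by simp), closure_Ioo (by simp)]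
  rw [hcl]
  refine mem_of_wind_ne_zero hole (.cons hu (p.concat hu')) (by simp) ?_
  intro q hq
  rw [Complex.mem_reProdIm] at hq
  obtain ⟨⟨h1', h1⟩, h2', h2⟩ := hq
  refine ⟨notMem_trace h1 h1' h2 h2' _, ?_⟩
  let l : ℕ × ℕ → ℂ := fun v => Complex.log (Complex.I * (gridPoint v - q))
  have hw : wind (.cons hu (p.concat hu')) q =
      Complex.log ((gridPoint u - q) / (gridPoint (m + 1, k + 1) - q)) + (l u' - l u) +
      Complex.log ((gridPoint (m + 1, k + 1) - q) / (gridPoint u' - q)) := by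
    rw [← sum_darts_eq_sub p l (q := q)]
    · simp [wind, add_assoc, SimpleGraph.Walk.darts_concat]
    intro d hd
    have hx := hmax _ (p.dart_fst_mem_support_of_mem_darts hd)
    have hy := hmax _ (p.dart_snd_mem_support_of_mem_darts hd)
    have hx' : d.fst ≠ (m + 1, k + 1) :=
      fun hc => hp (hc ▸ p.dart_fst_mem_support_of_mem_darts hd)
    have hy' : d.snd ≠ (m + 1, k + 1) :=
      fun hc => hp (hc ▸ p.dart_snd_mem_support_of_mem_darts hd)
    have hadj := d.adj.1
    refine log_edge (w := (m, k)) h1 h1' h2' ?_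
    rw [Ne, Prod.ext_iff] at hx' hy'
    unfold GridAdj at hadj
    simp only at hx hy hx' hy' hadj ⊢
    omega
  have htop := top_edge_im h1 h1' h2
  intro h0
  rw [hw] at h0
  have h0' := congrArg Complex.im h0
  rcases huu with ⟨rfl, rfl⟩ | ⟨rfl, rfl⟩
  · rw [log_edge (x := (m + 1, k)) (w := (m, k)) h1 h1' h2' (by simp)] at h0'
    have := Complex.neg_pi_lt_log_im
      ((gridPoint (m, k + 1) - q) / (gridPoint (m + 1, k + 1) - q))
    simp only [l, Complex.add_im, Complex.sub_im, Complex.zero_im] at h0' htop this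
    linarith
  · rw [log_edge (y := (m + 1, k)) (w := (m, k)) h1 h1' h2' (by simp)] at h0'
    have := Complex.log_im_le_pi
      ((gridPoint (m + 1, k + 1) - q) / (gridPoint (m, k + 1) - q))
    simp only [l, Complex.add_im, Complex.sub_im, Complex.zero_im] at h0' htop this
    linarith

end gridGraph

namespace gridGraph

variable {U : Set ℂ} {G : Type*} [Group G] (e : ℂ → ℂ → G)

/-- The product of a cocycle along a walk. -/
noncomputable def walkProd {v w : ℕ × ℕ} (p : (gridGraph U).Walk v w) : G :=
  (p.darts.map fun d => e (gridPoint d.fst) (gridPoint d.snd)).prod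

/-- The sum of the heights of the vertices of a walk, the last one excepted. -/
def weight {v w : ℕ × ℕ} (p : (gridGraph U).Walk v w) : ℕ :=
  (p.darts.map fun d => d.fst.1 + d.fst.2 + 1).sum

@[simp] theorem walkProd_nil {v : ℕ × ℕ} :
    walkProd e (.nil : (gridGraph U).Walk v v) = 1 := by simp [walkProd]

@[simp] theorem walkProd_cons {u v w : ℕ × ℕ} (h : (gridGraph U).Adj u v)
    (p : (gridGraph U).Walk v w) :
    walkProd e (.cons h p) = e (gridPoint u) (gridPoint v) * walkProd e p := by simp [walkProd]

@[simp] theorem walkProd_append {u v w : ℕ × ℕ} (p : (gridGraph U).Walk u v)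
    (q : (gridGraph U).Walk v w) : walkProd e (p.append q) = walkProd e p * walkProd e q := by
  simp [walkProd]

@[simp] theorem walkProd_concat {u v w : ℕ × ℕ} (p : (gridGraph U).Walk u v)
    (h : (gridGraph U).Adj v w) :
    walkProd e (p.concat h) = walkProd e p * e (gridPoint v) (gridPoint w) := by
  simp [walkProd, SimpleGraph.Walk.darts_concat]

@[simp] theorem weight_cons {u v w : ℕ × ℕ} (h : (gridGraph U).Adj u v)
    (p : (gridGraph U).Walk v w) : weight (.cons h p) = u.1 + u.2 + 1 + weight p := by
  simp [weight]

@[simp] theorem weight_append {u v w : ℕ × ℕ} (p : (gridGraph U).Walk u v)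
    (q : (gridGraph U).Walk v w) : weight (p.append q) = weight p + weight q := by
  simp [weight]

@[simp] theorem weight_concat {u v w : ℕ × ℕ} (p : (gridGraph U).Walk u v)
    (h : (gridGraph U).Adj v w) : weight (p.concat h) = weight p + (v.1 + v.2 + 1) := by
  simp [weight, SimpleGraph.Walk.darts_concat]

theorem walkProd_eq_one
    (hole : ∀ D : Set ℂ, IsOpen D → Bornology.IsBounded D → frontier D ⊆ U → D ⊆ U)
    (he : ∀ C ⊆ U, Convex ℝ C → ∀ a ∈ C, ∀ b ∈ C, ∀ c ∈ C, e a b * e b c = e a c)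
    (n : ℕ) : ∀ (v : ℕ × ℕ) (p : (gridGraph U).Walk v v), weight p ≤ n → walkProd e p = 1 := by
  induction n using Nat.strong_induction_on with
  | _ n ih =>
  intro v p hpn
  obtain ⟨w, hw, hmax⟩ : ∃ w ∈ p.support, ∀ x ∈ p.support, x.2 ≤ w.2 ∧
      (x.2 = w.2 → x.1 ≤ w.1) := by
    obtain ⟨w, hw, hw'⟩ := p.support.toFinset.exists_max_image
      (fun x => toLex (x.2, x.1)) ⟨v, by simp⟩
    refine ⟨w, by simpa using hw, fun x hx => ?_⟩
    have := hw' x (by simpa using hx)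
    rw [Prod.Lex.toLex_le_toLex] at this
    simp only at this
    omega
  -- move the base point to the extremal vertex
  have hsplit := p.take_spec hw
  set p₁ := p.takeUntil w hw
  set p₂ := p.dropUntil w hw
  suffices H : walkProd e (p₂.append p₁) = 1 by
    rw [← hsplit]
    rw [walkProd_append] at H ⊢
    exact mul_eq_one_comm.1 H
  have hmax' : ∀ x ∈ (p₂.append p₁).support, x.2 ≤ w.2 ∧ (x.2 = w.2 → x.1 ≤ w.1) := by
    intro x hx
    apply hmax
    rw [← hsplit]
    rw [SimpleGraph.Walk.mem_support_append_iff] at hx ⊢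
    tauto
  have hwt : weight (p₂.append p₁) ≤ n := by
    rw [← hsplit] at hpn
    rw [weight_append] at hpn ⊢
    omega
  generalize p₂.append p₁ = c at hmax' hwt
  clear hsplit hmax
  cases c with
  | nil => simp
  | @cons _ u _ hu c =>
  obtain ⟨u', q, hu', rfl⟩ : ∃ u', ∃ (q : (gridGraph U).Walk u u') (h : (gridGraph U).Adj u' w),
      c = q.concat h := by
    cases c with
    | nil => exact absurd hu (SimpleGraph.irrefl _)
    | cons h r =>
      obtain ⟨x, q, h', hq⟩ := SimpleGraph.Walk.exists_cons_eq_concat h r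
      exact ⟨x, q, h', hq⟩
  simp only [weight_cons, weight_concat] at hwt
  rw [walkProd_cons, walkProd_concat]
  by_cases hwq : w ∈ q.support
  · have hq := q.take_spec hwq
    set q₁ := q.takeUntil w hwq
    set q₂ := q.dropUntil w hwq
    rw [← hq, weight_append] at hwt
    have h1 := ih (weight (.cons hu q₁)) (by rw [weight_cons]; omega) w (.cons hu q₁) le_rfl
    have h2 := ih (weight (q₂.concat hu')) (by rw [weight_concat]; omega) w (q₂.concat hu') le_rfl
    rw [walkProd_cons] at h1
    rw [walkProd_concat] at h2
    rw [← hq, walkProd_append]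
    calc _ = (e (gridPoint w) (gridPoint u) * walkProd e q₁) *
          (walkProd e q₂ * e (gridPoint u') (gridPoint w)) := by group
      _ = 1 := by rw [h1, h2, one_mul]
  have hmem : ∀ x ∈ q.support, x.2 ≤ w.2 ∧ (x.2 = w.2 → x.1 ≤ w.1) := fun x hx =>
    hmax' x (by simp [SimpleGraph.Walk.support_concat, hx])
  have hu1 := hmem u (by simp)
  have hu1' := hmem u' (by simp)
  have hadj := hu.1
  have hadj' := hu'.1
  by_cases huu : u = u'
  · subst huu
    have hq := ih (weight q) (by omega) u q le_rfl
    have hs : e (gridPoint w) (gridPoint w) = 1 := by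
      have := he _ hu.2 (convex_segment _ _) _ (left_mem_segment _ _ _) _
        (left_mem_segment _ _ _) _ (left_mem_segment _ _ _)
      simpa using this
    rw [hq, one_mul, he _ hu.2 (convex_segment _ _) _ (left_mem_segment _ _ _) _
        (right_mem_segment _ _ _) _ (left_mem_segment _ _ _), hs]
  obtain ⟨a, b⟩ := w
  obtain ⟨x, y⟩ := u
  obtain ⟨x', y'⟩ := u'
  unfold GridAdj at hadj hadj'
  rw [Prod.mk.injEq] at huu
  simp only at hadj hadj' hu1 hu1'
  obtain ⟨m, rfl⟩ : ∃ m, a = m + 1 := ⟨a - 1, by omega⟩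
  obtain ⟨k, rfl⟩ : ∃ k, b = k + 1 := ⟨b - 1, by omega⟩
  have hcase : ((x, y) = (m, k + 1) ∧ (x', y') = (m + 1, k)) ∨
      ((x, y) = (m + 1, k) ∧ (x', y') = (m, k + 1)) := by
    simp only [Prod.mk.injEq]
    omega
  have hsq := square_subset hole hu hu' q hwq (fun x hx => hmem x hx) hcase
  have hconv : Convex ℝ (Icc (m : ℝ) (m + 1) ×ℂ Icc (k : ℝ) (k + 1)) := by
    rw [Complex.reProdIm]
    exact ((convex_Icc _ _).linear_preimage Complex.reLm).inter
      ((convex_Icc _ _).linear_preimage Complex.imLm)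
  have m1 : gridPoint (m, k) ∈ Icc (m : ℝ) (m + 1) ×ℂ Icc (k : ℝ) (k + 1) := by
    simp [Complex.mem_reProdIm, gridPoint]
  have m2 : gridPoint (m + 1, k) ∈ Icc (m : ℝ) (m + 1) ×ℂ Icc (k : ℝ) (k + 1) := by
    simp [Complex.mem_reProdIm, gridPoint]
  have m3 : gridPoint (m, k + 1) ∈ Icc (m : ℝ) (m + 1) ×ℂ Icc (k : ℝ) (k + 1) := by
    simp [Complex.mem_reProdIm, gridPoint]
  have m4 : gridPoint (m + 1, k + 1) ∈ Icc (m : ℝ) (m + 1) ×ℂ Icc (k : ℝ) (k + 1) := by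
    simp [Complex.mem_reProdIm, gridPoint]
  have mu : gridPoint (x, y) ∈ Icc (m : ℝ) (m + 1) ×ℂ Icc (k : ℝ) (k + 1) := by
    rcases hcase with ⟨h, -⟩ | ⟨h, -⟩ <;> rw [h] <;> assumption
  have mu' : gridPoint (x', y') ∈ Icc (m : ℝ) (m + 1) ×ℂ Icc (k : ℝ) (k + 1) := by
    rcases hcase with ⟨-, h⟩ | ⟨-, h⟩ <;> rw [h] <;> assumption
  have a1 : (gridGraph U).Adj (m, k) (x, y) := by
    refine ⟨?_, (hconv.segment_subset m1 mu).trans hsq⟩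
    rcases hcase with ⟨h, -⟩ | ⟨h, -⟩ <;> rw [h] <;> simp [GridAdj]
  have a2 : (gridGraph U).Adj (x', y') (m, k) := by
    refine ⟨?_, (hconv.segment_subset mu' m1).trans hsq⟩
    rcases hcase with ⟨-, h⟩ | ⟨-, h⟩ <;> rw [h] <;> simp [GridAdj]
  have hfin := ih (weight (.cons a1 (q.concat a2)))
    (by simp only [weight_cons, weight_concat]; omega) _ (.cons a1 (q.concat a2)) le_rfl
  rw [walkProd_cons, walkProd_concat] at hfin
  rw [← he _ hsq hconv _ m4 _ m1 _ mu, ← he _ hsq hconv _ mu' _ m1 _ m4]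
  have hs : e (gridPoint (m + 1, k + 1)) (gridPoint (m + 1, k + 1)) = 1 := by
    have := he _ hsq hconv _ m4 _ m4 _ m4
    simpa using this
  calc _ = e (gridPoint (m + 1, k + 1)) (gridPoint (m, k)) *
        (e (gridPoint (m, k)) (gridPoint (x, y)) * (walkProd e q *
          e (gridPoint (x', y')) (gridPoint (m, k)))) *
        e (gridPoint (m, k)) (gridPoint (m + 1, k + 1)) := by group
    _ = 1 := by rw [hfin, mul_one, he _ hsq hconv _ m4 _ m1 _ m4, hs]

end gridGraph

namespace gridGraph

variable {U : Set ℂ} {G : Type*} [Group G] (e : ℂ → ℂ → G)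

theorem exists_walk_of_le_one {C : Set ℂ} (hCU : C ⊆ U) (hC : Convex ℝ C)
    (he : ∀ C ⊆ U, Convex ℝ C → ∀ a ∈ C, ∀ b ∈ C, ∀ c ∈ C, e a b * e b c = e a c)
    {v w : ℕ × ℕ} (hv : gridPoint v ∈ C) (hw : gridPoint w ∈ C) (h : v = w ∨ GridAdj v w) :
    ∃ p : (gridGraph U).Walk v w, walkProd e p = e (gridPoint v) (gridPoint w) := by
  rcases h with rfl | h
  · refine ⟨.nil, ?_⟩
    have := he C hCU hC _ hv _ hv _ hv
    rw [mul_eq_left] at this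
    rw [walkProd_nil, this]
  · have hadj : (gridGraph U).Adj v w := ⟨h, (hC.segment_subset hv hw).trans hCU⟩
    exact ⟨.cons hadj .nil, by simp⟩

theorem gridAdj_of_snd_le (v w : ℕ × ℕ) (h : v.2 ≤ w.2 + 1) (h' : w.2 ≤ v.2 + 1) :
    v = (v.1, w.2) ∨ GridAdj v (v.1, w.2) := by
  have : v.2 = w.2 ∨ v.2 = w.2 + 1 ∨ w.2 = v.2 + 1 := by omega
  rcases this with h | h
  · exact Or.inl (Prod.ext rfl h)
  · exact Or.inr (Or.inl ⟨rfl, h⟩)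

theorem gridAdj_of_fst_le (v w : ℕ × ℕ) (h : v.1 ≤ w.1 + 1) (h' : w.1 ≤ v.1 + 1) :
    (v.1, w.2) = w ∨ GridAdj (v.1, w.2) w := by
  have : v.1 = w.1 ∨ v.1 = w.1 + 1 ∨ w.1 = v.1 + 1 := by omega
  rcases this with h | h
  · exact Or.inl (Prod.ext h rfl)
  · exact Or.inr (Or.inr ⟨rfl, h⟩)

/-- The lower left corner of the grid square containing a point. -/
noncomputable def floorVertex (z : ℂ) : ℕ × ℕ := (⌊z.re⌋₊, ⌊z.im⌋₊)

theorem cocycle_eq_one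
    (hole : ∀ D : Set ℂ, IsOpen D → Bornology.IsBounded D → frontier D ⊆ U → D ⊆ U)
    (he : ∀ C ⊆ U, Convex ℝ C → ∀ a ∈ C, ∀ b ∈ C, ∀ c ∈ C, e a b * e b c = e a c)
    {y : unitInterval → ℂ} (hy : Continuous y) (hyU : ∀ t, ball (y t) 4 ⊆ U)
    (hre : ∀ t, 0 ≤ (y t).re) (him : ∀ t, 0 ≤ (y t).im) (h01 : y 0 = y 1)
    {E : unitInterval → unitInterval → G} (hE : ∀ s t r, E s t * E t r = E s r)
    (hEe : ∀ C ⊆ U, Convex ℝ C → ∀ s t, (∀ r ∈ uIcc s t, y r ∈ C) → E s t = e (y s) (y t)) :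
    E 0 1 = 1 := by
  obtain ⟨δ, hδ, hδy⟩ := Metric.uniformContinuous_iff.1
    (CompactSpace.uniformContinuous_of_continuous hy) 1 one_pos
  obtain ⟨N, hN⟩ := exists_nat_one_div_lt hδ
  have hN0 : (0 : ℝ) < N + 1 := by positivity
  let t : ℕ → unitInterval := fun k => projIcc 0 1 zero_le_one ((k : ℝ) / (N + 1))
  have ht0 : t 0 = 0 := by
    apply Subtype.ext; simp [t]
  have ht1 : t (N + 1) = 1 := by
    apply Subtype.ext; simp only [t, coe_projIcc]; push_cast; rw [div_self hN0.ne']; simp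
  have htmono : ∀ k, t k ≤ t (k + 1) := fun k => by
    apply monotone_projIcc; push_cast; gcongr; linarith
  have htd : ∀ k, (t (k + 1) : ℝ) - t k < δ := by
    intro k
    refine lt_of_le_of_lt ?_ hN
    simp only [t, coe_projIcc]
    have : ((k + 1 : ℕ) : ℝ) / (N + 1) = k / (N + 1) + 1 / (N + 1) := by push_cast; ring
    rw [this]
    have h1 : 0 < 1 / ((N : ℝ) + 1) := by positivity
    generalize 1 / ((N : ℝ) + 1) = a at *
    generalize (k : ℝ) / (N + 1) = b at *
    grind
  have hclose : ∀ k, ∀ r ∈ uIcc (t k) (t (k + 1)), dist (y r) (y (t k)) < 1 := by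
    intro k r hr
    rw [uIcc_of_le (htmono k)] at hr
    apply hδy
    have h1 : (t k : ℝ) ≤ r := hr.1
    have : (r : ℝ) ≤ t (k + 1) := hr.2
    rw [Subtype.dist_eq, Real.dist_eq, abs_of_nonneg (sub_nonneg.2 h1)]
    linarith [htd k]
  let v : ℕ → ℕ × ℕ := fun k => floorVertex (y (t k))
  have hfl : ∀ s, ((floorVertex (y s)).1 : ℝ) ≤ (y s).re ∧ (y s).re < (floorVertex (y s)).1 + 1 ∧
      ((floorVertex (y s)).2 : ℝ) ≤ (y s).im ∧ (y s).im < (floorVertex (y s)).2 + 1 := fun s =>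
    ⟨Nat.floor_le (hre s), Nat.lt_floor_add_one _, Nat.floor_le (him s), Nat.lt_floor_add_one _⟩
  have hmem : ∀ (z : ℂ) (w : ℕ × ℕ) (a b : ℝ), |(w.1 : ℝ) - z.re| < a → |(w.2 : ℝ) - z.im| < b →
      a + b ≤ 4 → gridPoint w ∈ ball z 4 := by
    intro z w a b h1 h2 h3
    rw [mem_ball, dist_eq_norm]
    refine (Complex.norm_le_abs_re_add_abs_im _).trans_lt ?_
    simp only [Complex.sub_re, Complex.sub_im, gridPoint_re, gridPoint_im]
    linarith
  have hself : ∀ k, gridPoint (v k) ∈ ball (y (t k)) 4 := by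
    intro k
    have h := hfl (t k)
    refine hmem _ _ 2 2 ?_ ?_ (by norm_num) <;> rw [abs_lt] <;> constructor <;>
      simp only [v] <;> linarith
  have claim : ∀ k, ∃ p : (gridGraph U).Walk (v 0) (v k),
      e (y 0) (gridPoint (v 0)) * walkProd e p * e (gridPoint (v k)) (y (t k)) = E 0 (t k) := by
    intro k
    induction k with
    | zero =>
      refine ⟨.nil, ?_⟩
      have hc := hself 0
      rw [ht0] at hc ⊢
      have hb : y 0 ∈ ball (y 0) 4 := mem_ball_self (by norm_num)
      have hEs := hE 0 0 0
      rw [walkProd_nil, mul_one, he _ (hyU 0) (convex_ball _ _) _ hb _ hc _ hb]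
      have := he _ (hyU 0) (convex_ball _ _) _ hb _ hb _ hb
      rw [mul_eq_left] at this hEs
      rw [this, hEs]
    | succ k ih =>
      obtain ⟨p, hp⟩ := ih
      have hCU := hyU (t k)
      have hC := convex_ball (y (t k)) 4
      have d1 := hclose k _ right_mem_uIcc
      rw [dist_eq_norm] at d1
      have dre := (Complex.abs_re_le_norm _).trans_lt d1
      have dim := (Complex.abs_im_le_norm _).trans_lt d1
      rw [Complex.sub_re, abs_lt] at dre
      rw [Complex.sub_im, abs_lt] at dim
      have f1 := hfl (t k)
      have f2 := hfl (t (k + 1))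
      have b0 : y (t k) ∈ ball (y (t k)) 4 := mem_ball_self (by norm_num)
      have b1 : y (t (k + 1)) ∈ ball (y (t k)) 4 := by
        rw [mem_ball, dist_eq_norm]; linarith
      have b2 := hself k
      have b3 : gridPoint (v (k + 1)) ∈ ball (y (t k)) 4 := by
        refine hmem _ _ 2 2 ?_ ?_ (by norm_num) <;> rw [abs_lt] <;> constructor <;>
          simp only [v] <;> linarith
      have b4 : gridPoint ((v k).1, (v (k + 1)).2) ∈ ball (y (t k)) 4 := by
        refine hmem _ _ 2 2 ?_ ?_ (by norm_num) <;> rw [abs_lt] <;> constructor <;>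
          simp only [v] <;> linarith
      have n1 : (v k).2 ≤ (v (k + 1)).2 + 1 := by
        have : ((v k).2 : ℝ) < (v (k + 1)).2 + 1 + 1 := by simp only [v]; linarith
        norm_cast at this; omega
      have n2 : (v (k + 1)).2 ≤ (v k).2 + 1 := by
        have : ((v (k + 1)).2 : ℝ) < (v k).2 + 1 + 1 := by simp only [v]; linarith
        norm_cast at this; omega
      have n3 : (v k).1 ≤ (v (k + 1)).1 + 1 := by
        have : ((v k).1 : ℝ) < (v (k + 1)).1 + 1 + 1 := by simp only [v]; linarith
        norm_cast at this; omega
      have n4 : (v (k + 1)).1 ≤ (v k).1 + 1 := by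
        have : ((v (k + 1)).1 : ℝ) < (v k).1 + 1 + 1 := by simp only [v]; linarith
        norm_cast at this; omega
      obtain ⟨q, hq⟩ := exists_walk_of_le_one e hCU hC he b2 b4
        (gridAdj_of_snd_le _ _ n1 n2)
      obtain ⟨r, hr⟩ := exists_walk_of_le_one e hCU hC he b4 b3
        (gridAdj_of_fst_le _ _ n3 n4)
      refine ⟨p.append (q.append r), ?_⟩
      have hEk : E (t k) (t (k + 1)) = e (y (t k)) (y (t (k + 1))) := by
        refine hEe _ hCU hC _ _ fun s hs => ?_
        rw [mem_ball]; linarith [hclose k s hs]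
      rw [← hE 0 (t k), ← hp, hEk, walkProd_append, walkProd_append, hq, hr,
        he _ hCU hC _ b2 _ b4 _ b3, mul_assoc _ (e _ _) (e _ _), he _ hCU hC _ b2 _ b0 _ b1,
        mul_assoc, mul_assoc, mul_assoc, he _ hCU hC _ b2 _ b3 _ b1]
  obtain ⟨p, hp⟩ := claim (N + 1)
  have hv : v (N + 1) = v 0 := by simp only [v]; rw [ht1, ht0, h01]
  have hb : y 0 ∈ ball (y 0) 4 := mem_ball_self (by norm_num)
  have hc := hself 0
  rw [ht0] at hc
  rw [ht1, ← h01] at hp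
  rw [← hp]
  clear hp
  generalize v (N + 1) = w at p hv
  subst hv
  rw [walkProd_eq_one e hole he _ _ p le_rfl, mul_one,
    he _ (hyU 0) (convex_ball _ _) _ hb _ hc _ hb]
  have := he _ (hyU 0) (convex_ball _ _) _ hb _ hb _ hb
  rwa [mul_eq_left] at this

end gridGraph

/-- A path connected open subset of the plane whose holes are all filled is simply connected. -/
theorem simplyConnectedSpace_of_frontier_subset {U : Set ℂ} (hU : IsOpen U) (hc : IsConnected U)
    (hole : ∀ D : Set ℂ, IsOpen D → Bornology.IsBounded D → frontier D ⊆ U → D ⊆ U) :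
    SimplyConnectedSpace U := by
  have hpc : PathConnectedSpace U := isPathConnected_iff_pathConnectedSpace.1
    (hU.isConnected_iff_isPathConnected.1 hc)
  rw [simply_connected_iff_loops_nullhomotopic]
  refine ⟨hpc, fun x γ => ?_⟩
  obtain ⟨G, _, e, E, he, hE, hEe, hE1⟩ := exists_edge_cocycle γ
  apply hE1
  have hK : IsCompact (range fun t => (γ t : ℂ)) := isCompact_range (by fun_prop)
  obtain ⟨δ, hδ, hδU⟩ := hK.exists_thickening_subset_open hU (by rintro _ ⟨t, rfl⟩; exact (γ t).2)
  obtain ⟨R, hR⟩ := hK.isBounded.subset_ball 0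
  have hδ' : (δ / 4 : ℂ) ≠ 0 := by
    have : (δ : ℂ) ≠ 0 := by exact_mod_cast hδ.ne'
    simpa using this
  let A : ℂ ≃ₜ ℂ := (Homeomorph.mulLeft₀ (δ / 4 : ℂ) hδ').trans
    (Homeomorph.addRight (⟨-R, -R⟩ : ℂ))
  have hA : ∀ z, A z = (δ / 4 : ℂ) * z + ⟨-R, -R⟩ := fun z => rfl
  have hAs : ∀ z, A.symm z = (δ / 4 : ℂ)⁻¹ * (z - ⟨-R, -R⟩) := by
    intro z
    rw [A.symm_apply_eq, hA]
    rw [mul_inv_cancel_left₀ hδ']; ring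
  have hAconv : ∀ C, Convex ℝ C → Convex ℝ (A '' C) := by
    intro C hC
    have : A '' C = (fun z => z + (⟨-R, -R⟩ : ℂ)) '' ((fun z => (δ / 4 : ℝ) • z) '' C) := by
      rw [image_image]
      refine image_congr fun z _ => ?_
      rw [hA]; simp
    rw [this]
    have h1 : Convex ℝ ((fun z => (δ / 4 : ℝ) • z) '' C) := hC.smul (δ / 4)
    simpa only [add_comm] using h1.translate (⟨-R, -R⟩ : ℂ)
  have main := gridGraph.cocycle_eq_one (U := A ⁻¹' U) (G := Gᵐᵒᵖ)
    (fun a b => MulOpposite.op (e (A a) (A b))) ?_ ?_ (y := fun t => A.symm (γ t)) ?_ ?_ ?_ ?_ ?_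
    (E := fun s t => MulOpposite.op (E s t)) ?_ ?_
  · simpa using main
  · intro D hD hb hfr
    rw [← image_subset_iff]
    apply hole _ (A.isOpenMap D hD)
    · have : Bornology.IsBounded (A '' closure D) :=
        ((hb.isCompact_closure).image A.continuous).isBounded
      exact this.subset (image_mono subset_closure)
    · rw [← A.image_frontier, image_subset_iff]
      exact hfr
  · intro C hC hCc a ha b hb c hcc
    rw [← MulOpposite.op_mul]
    congr 1
    exact he (A '' C) (image_subset_iff.2 hC) (hAconv C hCc) _ (mem_image_of_mem _ ha) _
      (mem_image_of_mem _ hb) _ (mem_image_of_mem _ hcc)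
  · fun_prop
  · intro t z hz
    apply hδU
    rw [mem_thickening_iff]
    refine ⟨γ t, mem_range_self t, ?_⟩
    rw [mem_ball, dist_eq_norm] at hz
    have h1 : A z - γ t = (δ / 4 : ℂ) * (z - A.symm (γ t)) := by
      rw [hA, hAs, mul_sub, mul_inv_cancel_left₀ hδ']; ring
    rw [dist_eq_norm, h1, norm_mul]
    have h2 : ‖(δ / 4 : ℂ)‖ = δ / 4 := by
      rw [norm_div, Complex.norm_real, Real.norm_of_nonneg hδ.le]; simp
    rw [h2]
    nlinarith
  · intro t
    have h1 := hR (mem_range_self t)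
    simp only [mem_ball, dist_zero_right] at h1
    have h2 := (Complex.abs_re_le_norm _).trans_lt h1
    have h3 : (δ / 4 : ℂ)⁻¹ = ((δ / 4 : ℝ)⁻¹ : ℝ) := by push_cast; rfl
    rw [hAs, h3, Complex.re_ofReal_mul]
    rw [abs_lt] at h2
    have : 0 ≤ ((γ t : ℂ) - ⟨-R, -R⟩).re := by simp; linarith
    positivity
  · intro t
    have h1 := hR (mem_range_self t)
    simp only [mem_ball, dist_zero_right] at h1
    have h2 := (Complex.abs_im_le_norm _).trans_lt h1
    have h3 : (δ / 4 : ℂ)⁻¹ = ((δ / 4 : ℝ)⁻¹ : ℝ) := by push_cast; rfl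
    rw [hAs, h3, Complex.im_ofReal_mul]
    rw [abs_lt] at h2
    have : 0 ≤ ((γ t : ℂ) - ⟨-R, -R⟩).im := by simp; linarith
    positivity
  · simp
  · intro s t r
    rw [← MulOpposite.op_mul, hE]
  · intro C hC hCc s t h
    congr 1
    simp only [Homeomorph.apply_symm_apply]
    refine hEe (A '' C) (image_subset_iff.2 hC) (hAconv C hCc) s t fun r hr => ?_
    exact ⟨_, h r hr, by simp⟩

/-- If the image of the boundary of `D` misses a connected set which meets the image of `D`, the
connected set is covered by the image of `D`. -/
theorem subset_image_of_disjoint_frontier {h : ℂ → ℂ} (hc : Continuous h) (ho : IsOpenMap h)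
    {D S : Set ℂ} (hD : IsOpen D) (hb : Bornology.IsBounded D) (hS : IsPreconnected S)
    (hfr : ∀ z ∈ frontier D, h z ∉ S) {z : ℂ} (hz : z ∈ D) (hzS : h z ∈ S) : S ⊆ h '' D := by
  have hcl : IsClosed (h '' closure D) := (hb.isCompact_closure.image hc).isClosed
  refine IsPreconnected.subset_left_of_subset_union (ho D hD) hcl.isOpen_compl ?_ ?_
    ⟨h z, hzS, mem_image_of_mem h hz⟩ hS
  · exact disjoint_compl_right_iff_subset.2 (image_mono subset_closure)
  · intro w hw
    by_cases hwc : w ∈ h '' closure D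
    · obtain ⟨x, hx, rfl⟩ := hwc
      rw [closure_eq_self_union_frontier] at hx
      rcases hx with hx | hx
      · exact Or.inl (mem_image_of_mem h hx)
      · exact absurd hw (hfr x hx)
    · exact Or.inr hwc

/-- Bloch's theorem: the image of a disc contains a disc of radius comparable to the derivative at
the centre. -/
theorem exists_ball_subset_image {F : ℂ → ℂ} {V : Set ℂ} (hV : IsOpen V)
    (hF : DifferentiableOn ℂ F V) {z₀ : ℂ} {δ : ℝ} (hδ : 0 < δ) (hδV : closedBall z₀ δ ⊆ V) :
    ∃ z₁ ∈ closedBall z₀ δ, ball (F z₁) (δ * ‖deriv F z₀‖ / 48) ⊆ F '' closedBall z₀ δ := by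
  have hF' : DifferentiableOn ℂ (deriv F) V := hF.deriv hV
  by_cases h0 : deriv F z₀ = 0
  · exact ⟨z₀, mem_closedBall_self hδ.le, by simp [h0]⟩
  obtain ⟨z₁, hz₁, hmax⟩ := (isCompact_closedBall z₀ δ).exists_isMaxOn
    ⟨z₀, mem_closedBall_self hδ.le⟩ (f := fun z => (δ - dist z z₀) * ‖deriv F z‖)
    (ContinuousOn.mul (by fun_prop) ((hF'.continuousOn.mono hδV).norm))
  refine ⟨z₁, hz₁, ?_⟩
  have hm0 := hmax (mem_closedBall_self hδ.le)
  simp only [mem_ofPred_eq, dist_self, sub_zero] at hm0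
  have hn0 : 0 < ‖deriv F z₀‖ := norm_pos_iff.2 h0
  have hd0 : 0 ≤ δ - dist z₁ z₀ := sub_nonneg.2 hz₁
  have hpos : 0 < (δ - dist z₁ z₀) * ‖deriv F z₁‖ := lt_of_lt_of_le (by positivity) hm0
  have hd : 0 < δ - dist z₁ z₀ := pos_of_mul_pos_left hpos (norm_nonneg _)
  set a := deriv F z₁ with ha
  have han : 0 < ‖a‖ := pos_of_mul_pos_right hpos hd0
  set ρ := (δ - dist z₁ z₀) / 2 with hρ
  have hρ0 : 0 < ρ := by positivity
  have hsub : ball z₁ ρ ⊆ closedBall z₀ δ := by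
    intro z hz
    rw [mem_ball] at hz
    rw [mem_closedBall]
    linarith [dist_triangle z z₁ z₀]
  have hbd : ∀ z ∈ ball z₁ ρ, ‖deriv F z‖ ≤ 2 * ‖a‖ := by
    intro z hz
    have h1 := hmax (hsub hz)
    simp only [mem_ofPred_eq] at h1
    rw [mem_ball] at hz
    have h2 : ρ ≤ δ - dist z z₀ := by linarith [dist_triangle z z₁ z₀]
    have h3 : ρ * ‖deriv F z‖ ≤ ρ * (2 * ‖a‖) := by
      calc ρ * ‖deriv F z‖ ≤ (δ - dist z z₀) * ‖deriv F z‖ := by gcongr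
        _ ≤ (δ - dist z₁ z₀) * ‖a‖ := h1
        _ = ρ * (2 * ‖a‖) := by rw [hρ]; ring
    exact le_of_mul_le_mul_left h3 hρ0
  have hsch : ∀ z ∈ closedBall z₁ (ρ / 6), ‖deriv F z - a‖ ≤ ‖a‖ / 2 := by
    intro z hz
    have hz' : z ∈ ball z₁ ρ := closedBall_subset_ball (by linarith) hz
    have := Complex.dist_le_div_mul_dist_of_mapsTo_ball (R₂ := 3 * ‖a‖)
      (hF'.mono (hsub.trans hδV)) ?_ hz'
    · rw [dist_eq_norm] at this
      refine this.trans ?_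
      calc 3 * ‖a‖ / ρ * dist z z₁ ≤ 3 * ‖a‖ / ρ * (ρ / 6) := by gcongr; exact hz
        _ = ‖a‖ / 2 := by field_simp; norm_num
    · intro w hw
      rw [mem_closedBall, dist_eq_norm]
      calc ‖deriv F w - deriv F z₁‖ ≤ ‖deriv F w‖ + ‖deriv F z₁‖ := norm_sub_le _ _
        _ ≤ 3 * ‖a‖ := by linarith [hbd w hw]
  have hcsub : closedBall z₁ (ρ / 6) ⊆ V :=
    (closedBall_subset_ball (by linarith)).trans (hsub.trans hδV)
  have hdiff : ∀ z ∈ closedBall z₁ (ρ / 6), DifferentiableAt ℂ F z := fun z hz =>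
    hF.differentiableAt (hV.mem_nhds (hcsub hz))
  have hlow : ∀ z ∈ closedBall z₁ (ρ / 6), ‖a‖ / 2 * ‖z - z₁‖ ≤ ‖F z - F z₁‖ := by
    intro z hz
    have h1 := (convex_closedBall z₁ (ρ / 6)).norm_image_sub_le_of_norm_deriv_le
      (f := fun z => F z - a * z) (C := ‖a‖ / 2) (x := z₁) (y := z)
      (fun x hx => (hdiff x hx).sub (by fun_prop)) (fun x hx => ?_)
      (mem_closedBall_self (by positivity)) hz
    · have h2 : ‖a * (z - z₁)‖ ≤ ‖F z - F z₁‖ + ‖(F z - a * z) - (F z₁ - a * z₁)‖ := by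
        have : a * (z - z₁) = (F z - F z₁) - ((F z - a * z) - (F z₁ - a * z₁)) := by ring
        rw [this]
        exact norm_sub_le _ _
      rw [norm_mul] at h2
      linarith
    · have : deriv (fun z => F z - a * z) x = deriv F x - a := by
        rw [deriv_fun_sub (hdiff x hx) (by fun_prop)]
        simp
      rw [this]
      exact hsch x hx
  have hfin := DiffContOnCl.ball_subset_image_closedBall (f := F) (z₀ := z₁) (r := ρ / 6)
    (ε := ‖a‖ * ρ / 12) ⟨hF.mono (ball_subset_closedBall.trans hcsub),
      (hF.continuousOn.mono (closure_ball_subset_closedBall.trans hcsub))⟩ (by positivity) ?_ ?_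
  · refine (ball_subset_ball ?_).trans (hfin.trans (image_mono ?_))
    · have : (δ - dist z₁ z₀) * ‖a‖ = 2 * (‖a‖ * ρ) := by rw [hρ]; ring
      linarith
    · exact (closedBall_subset_ball (by linarith)).trans hsub
  · intro z hz
    have := hlow z (sphere_subset_closedBall hz)
    rw [← dist_eq_norm, mem_sphere.1 hz] at this
    linarith
  · refine Eventually.frequently (f := 𝓝[≠] z₁) ?_ |>.filter_mono nhdsWithin_le_nhds
    filter_upwards [self_mem_nhdsWithin,
      mem_nhdsWithin_of_mem_nhds (closedBall_mem_nhds z₁ (by positivity : 0 < ρ / 6))] with z hz hz'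
    intro hc
    have := hlow z hz'
    rw [hc, sub_self, norm_zero] at this
    have h3 : 0 < ‖z - z₁‖ := norm_pos_iff.2 (sub_ne_zero.2 hz)
    nlinarith

/-- Only finitely many members of a disjoint family can contain a disc of given radius with centre
in a given bounded set. -/
theorem eventually_not_ball_subset {S : ℕ → Set ℂ} (hS : Pairwise fun m n => Disjoint (S m) (S n))
    (B : ℝ) {η : ℝ} (hη : 0 < η) : ∀ᶠ n in atTop, ∀ c : ℂ, ‖c‖ ≤ B → ¬ ball c η ⊆ S n := by
  by_contra hcon
  have hfreq : ∃ᶠ n in atTop, ∃ c : ℂ, ‖c‖ ≤ B ∧ ball c η ⊆ S n := by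
    intro h
    apply hcon
    filter_upwards [h] with n hn c hc hcS
    exact hn ⟨c, hc, hcS⟩
  obtain ⟨φ, hφ, hφc⟩ := extraction_of_frequently_atTop hfreq
  choose c hcB hcS using hφc
  obtain ⟨a, -, ψ, hψ, ha⟩ := tendsto_subseq_of_bounded (isBounded_closedBall (x := (0 : ℂ)) (r := B))
    (x := c) (fun n => by simpa using hcB n)
  have h1 := ha.eventually (ball_mem_nhds a hη)
  obtain ⟨N, hN⟩ := eventually_atTop.1 h1
  have h2 := hN N le_rfl
  have h3 := hN (N + 1) (by omega)
  have hne : φ (ψ N) ≠ φ (ψ (N + 1)) := (hφ (hψ (Nat.lt_succ_self N))).ne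
  have hmem : a ∈ S (φ (ψ N)) := hcS _ (mem_ball'.2 h2)
  have hmem_succ : a ∈ S (φ (ψ (N + 1))) := hcS _ (mem_ball'.2 h3)
  exact Set.disjoint_left.1 (hS hne) hmem hmem_succ

/-- Uniformly bounded holomorphic functions with disjoint images have small derivatives. -/
theorem eventually_norm_deriv_le {S : ℕ → Set ℂ} (hS : Pairwise fun m n => Disjoint (S m) (S n))
    {F : ℕ → ℂ → ℂ} {P : ℕ → Prop} {z : ℂ} {r B : ℝ} (hr : 0 < r)
    (hF : ∀ n, P n → DifferentiableOn ℂ (F n) (ball z (2 * r)) ∧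
      ∀ w ∈ ball z (2 * r), F n w ∈ S n ∧ ‖F n w‖ ≤ B) {η : ℝ} (hη : 0 < η) :
    ∀ᶠ n in atTop, P n → ∀ w ∈ ball z r, ‖deriv (F n) w‖ ≤ η := by
  filter_upwards [eventually_not_ball_subset hS B (η := (r / 2) * η / 48) (by positivity)] with
    n hn hP w hw
  by_contra hc
  push Not at hc
  obtain ⟨hd, hb⟩ := hF n hP
  have hsub : closedBall w (r / 2) ⊆ ball z (2 * r) := by
    intro x hx
    rw [mem_ball] at hw ⊢
    rw [mem_closedBall] at hx
    linarith [dist_triangle x w z]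
  obtain ⟨z₁, hz₁, hz₁'⟩ := exists_ball_subset_image isOpen_ball hd (by positivity) hsub
  refine hn _ (hb z₁ (hsub hz₁)).2 ((ball_subset_ball ?_).trans (hz₁'.trans ?_))
  · gcongr
  · rintro _ ⟨x, hx, rfl⟩
    exact (hb x (hsub hx)).1

theorem differentiable_dslope {f : ℂ → ℂ} (hf : Differentiable ℂ f) (c : ℂ) :
    Differentiable ℂ (dslope f c) :=
  differentiableOn_univ.1 ((Complex.differentiableOn_dslope univ_mem).2 hf.differentiableOn)

theorem norm_dslope_le {f : ℂ → ℂ} {c z : ℂ} (hz : z ≠ c) :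
    ‖dslope f c z‖ ≤ (‖f z‖ + ‖f c‖) / ‖z - c‖ := by
  have h0 : 0 < ‖z - c‖ := norm_pos_iff.2 (sub_ne_zero.2 hz)
  rw [le_div_iff₀ h0, ← norm_mul, mul_comm, ← smul_eq_mul, sub_smul_dslope]
  exact norm_sub_le _ _

theorem eq_add_mul_dslope (f : ℂ → ℂ) (c z : ℂ) : f z = f c + (z - c) * dslope f c z := by
  rw [← smul_eq_mul, sub_smul_dslope]; ring

/-- An entire function of polynomial growth is a polynomial. -/
theorem exists_polynomial_of_norm_le (n : ℕ) : ∀ {f : ℂ → ℂ}, Differentiable ℂ f → ∀ {C : ℝ},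
    (∀ w, ‖f w‖ ≤ C * (1 + ‖w‖) ^ n) → ∃ p : Polynomial ℂ, ∀ z, f z = p.eval z := by
  induction n with
  | zero =>
    intro f hf C hC
    refine ⟨Polynomial.C (f 0), fun z => ?_⟩
    rw [Polynomial.eval_C]
    refine hf.apply_eq_apply_of_bounded ?_ z 0
    refine (isBounded_closedBall (x := (0 : ℂ)) (r := C)).subset ?_
    rintro _ ⟨w, rfl⟩
    simpa using hC w
  | succ n ih =>
    intro f hf C hC
    obtain ⟨M, hM⟩ := (isCompact_closedBall (0 : ℂ) 1).exists_bound_of_continuousOn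
      (f := dslope f 0) (differentiable_dslope hf 0).continuous.continuousOn
    have hC0 : 0 ≤ C := by simpa using (norm_nonneg _).trans (hC 0)
    have hM0 : 0 ≤ M := (norm_nonneg _).trans (hM 0 (by simp))
    obtain ⟨p, hp⟩ := ih (differentiable_dslope hf 0) (C := max M (4 * C)) (fun w => by
      have h1 : (1 : ℝ) ≤ (1 + ‖w‖) ^ n := one_le_pow₀ (by linarith [norm_nonneg w])
      rcases le_or_gt ‖w‖ 1 with hw | hw
      · refine (hM w (by simpa using hw)).trans ?_
        calc M = M * 1 := (mul_one _).symm
          _ ≤ max M (4 * C) * (1 + ‖w‖) ^ n := by gcongr; exact le_max_left _ _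
      · have hw0 : w ≠ 0 := norm_pos_iff.1 (by linarith)
        refine (norm_dslope_le hw0).trans ?_
        rw [sub_zero, div_le_iff₀ (by linarith)]
        have h2 := hC w
        have h3 : ‖f 0‖ ≤ C * (1 + ‖w‖) ^ n * ‖w‖ := by
          have := hC 0
          simp only [norm_zero, add_zero, one_pow, mul_one] at this
          calc ‖f 0‖ ≤ C * 1 * 1 := by linarith
            _ ≤ C * (1 + ‖w‖) ^ n * ‖w‖ := by gcongr
        have h4 : C * (1 + ‖w‖) ^ (n + 1) ≤ C * (1 + ‖w‖) ^ n * (2 * ‖w‖) := by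
          rw [pow_succ, ← mul_assoc]
          gcongr
          linarith
        calc ‖f w‖ + ‖f 0‖ ≤ 3 * C * (1 + ‖w‖) ^ n * ‖w‖ := by linarith
          _ ≤ max M (4 * C) * (1 + ‖w‖) ^ n * ‖w‖ := by
            gcongr
            exact le_trans (by linarith) (le_max_right _ _))
    refine ⟨Polynomial.C (f 0) + Polynomial.X * p, fun z => ?_⟩
    rw [eq_add_mul_dslope f 0 z, hp]
    simp

/-- A transcendental entire function comes close to every value near infinity. -/
theorem TranscendentalEntire.exists_norm_sub_lt {f : ℂ → ℂ} (hf : TranscendentalEntire f) (b : ℂ)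
    {ε : ℝ} (hε : 0 < ε) (R : ℝ) : ∃ z, R < ‖z‖ ∧ ‖f z - b‖ < ε := by
  by_contra! hcon
  apply hf.2
  set T := max R 1 with hT
  have hT0 : 0 < T := by positivity
  have hlow : ∀ w ∈ ball (0 : ℂ) T⁻¹ \ {0}, ε ≤ ‖f w⁻¹ - b‖ := by
    rintro w ⟨hw, hw0⟩
    apply hcon
    rw [mem_ball_zero_iff] at hw
    have hw0' : 0 < ‖w‖ := norm_pos_iff.2 hw0
    rw [norm_inv]
    exact (le_max_left R 1).trans_lt ((lt_inv_comm₀ hw0' hT0).1 hw)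
  set g : ℂ → ℂ := fun w => (f w⁻¹ - b)⁻¹ with hg
  have hgd : DifferentiableOn ℂ g (ball (0 : ℂ) T⁻¹ \ {0}) := by
    intro w hw
    have h1 : f w⁻¹ - b ≠ 0 := norm_pos_iff.1 (hε.trans_le (hlow w hw))
    exact (((hf.1 _).comp w (differentiableAt_inv hw.2)).sub_const b).inv h1
      |>.differentiableWithinAt
  have hnh : ball (0 : ℂ) T⁻¹ ∈ 𝓝 0 := ball_mem_nhds _ (by positivity)
  have hG := Complex.differentiableOn_update_limUnder_of_bddAbove hnh hgd ⟨ε⁻¹, by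
    rintro _ ⟨w, hw, rfl⟩
    simp only [Function.comp, hg, norm_inv]
    exact inv_anti₀ hε (hlow w hw)⟩
  set G := Function.update g 0 (limUnder (𝓝[≠] (0 : ℂ)) g) with hGdef
  have hGa : AnalyticAt ℂ G 0 := hG.analyticAt hnh
  have hGg : ∀ w ≠ 0, G w = g w := fun w hw => Function.update_of_ne hw _ _
  obtain ⟨n, h, hha, hh0, hGh⟩ := hGa.exists_eventuallyEq_pow_smul_nonzero_iff.2 (by
    intro h0
    obtain ⟨w, ⟨h1, h2⟩, h3⟩ := (((h0.and hnh).filter_mono nhdsWithin_le_nhds).and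
      (self_mem_nhdsWithin (s := {(0 : ℂ)}ᶜ))).exists
    rw [hGg w h3] at h1
    have := hlow w ⟨h2, h3⟩
    rw [inv_eq_zero.1 h1, norm_zero] at this
    linarith)
  have hhl : ∀ᶠ w in 𝓝 (0 : ℂ), ‖h 0‖ / 2 < ‖h w‖ :=
    hha.continuousAt.norm.eventually_const_lt (half_lt_self (norm_pos_iff.2 hh0))
  obtain ⟨δ, hδ, hδ'⟩ := Metric.eventually_nhds_iff_ball.1 ((hGh.and hhl).and hnh)
  have hc0 : 0 < ‖h 0‖ := norm_pos_iff.2 hh0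
  obtain ⟨M, hM⟩ := (isCompact_closedBall (0 : ℂ) δ⁻¹).exists_bound_of_continuousOn
      (f := f) hf.1.continuous.continuousOn
  have hM0 : 0 ≤ M := (norm_nonneg _).trans (hM 0 (by simpa using hδ.le))
  refine exists_polynomial_of_norm_le n hf.1 (C := M + ‖b‖ + 2 / ‖h 0‖) fun w => ?_
  have h1 : (1 : ℝ) ≤ (1 + ‖w‖) ^ n := one_le_pow₀ (by linarith [norm_nonneg w])
  rcases le_or_gt ‖w‖ δ⁻¹ with hw | hw
  · calc ‖f w‖ ≤ M := hM w (by simpa using hw)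
      _ ≤ (M + ‖b‖ + 2 / ‖h 0‖) * 1 := by
        have : 0 ≤ 2 / ‖h 0‖ := by positivity
        linarith [norm_nonneg b]
      _ ≤ _ := by gcongr
  · have hw0 : 0 < ‖w‖ := lt_trans (by positivity) hw
    have hw0' : w ≠ 0 := norm_pos_iff.1 hw0
    obtain ⟨⟨h2, h3⟩, h4⟩ := hδ' w⁻¹ (by
      rw [mem_ball_zero_iff, norm_inv]
      exact (inv_lt_comm₀ hw0 hδ).2 hw)
    rw [hGg _ (inv_ne_zero hw0'), sub_zero, smul_eq_mul] at h2
    simp only [hg, inv_inv] at h2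
    have h5 : f w - b = w ^ n * (h w⁻¹)⁻¹ := by
      rw [← inv_inj, h2, mul_inv, inv_inv, inv_pow]
    have h6 : ‖f w - b‖ ≤ (1 + ‖w‖) ^ n * (2 / ‖h 0‖) := by
      rw [h5, norm_mul, norm_pow, norm_inv]
      gcongr
      · linarith
      · rw [inv_le_comm₀ (by linarith) (by positivity), inv_div]
        exact h3.le
    calc ‖f w‖ ≤ ‖f w - b‖ + ‖b‖ := by
          have := norm_add_le (f w - b) b
          simpa using this
      _ ≤ (1 + ‖w‖) ^ n * (2 / ‖h 0‖) + ‖b‖ * (1 + ‖w‖) ^ n := by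
        gcongr
        exact le_mul_of_one_le_right (norm_nonneg _) h1
      _ ≤ _ := by nlinarith [mul_nonneg hM0 (zero_le_one.trans h1)]

theorem TranscendentalEntire.isOpenMap {f : ℂ → ℂ} (hf : TranscendentalEntire f) : IsOpenMap f := by
  have ha : AnalyticOnNhd ℂ f univ :=
    (Complex.analyticOnNhd_iff_differentiableOn isOpen_univ).2 hf.1.differentiableOn
  refine ha.is_constant_or_isOpenMap.resolve_left ?_
  rintro ⟨w, hw⟩
  exact hf.2 ⟨Polynomial.C w, by simpa using hw⟩

/-- A transcendental entire function has, for each `k`, values in any given open set which are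
taken at least `k` times. -/
theorem TranscendentalEntire.exists_card_fiber {f : ℂ → ℂ} (hf : TranscendentalEntire f)
    {B : Set ℂ} (hB : IsOpen B) (hB' : B.Nonempty) (k : ℕ) :
    ∃ R : ℝ, ∃ B' ⊆ B, IsOpen B' ∧ B'.Nonempty ∧ ∀ a ∈ B', ∃ s : Finset ℂ,
      s.card = k ∧ ∀ q ∈ s, ‖q‖ ≤ R ∧ f q = a := by
  induction k with
  | zero => exact ⟨0, B, subset_rfl, hB, hB', fun a _ => ⟨∅, by simp⟩⟩
  | succ k ih =>
    obtain ⟨R, B', hsub, ho, ⟨b, hb⟩, hs⟩ := ih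
    obtain ⟨ε, hε, hεB⟩ := Metric.isOpen_iff.1 ho b hb
    obtain ⟨z, hzR, hz⟩ := hf.exists_norm_sub_lt b hε R
    have hO : IsOpen (ball z 1 \ closedBall 0 R) := isOpen_ball.sdiff isClosed_closedBall
    refine ⟨max R (‖z‖ + 1), B' ∩ f '' (ball z 1 \ closedBall 0 R), inter_subset_left.trans hsub,
      ho.inter (hf.isOpenMap _ hO), ⟨f z, hεB ?_, z, ⟨mem_ball_self one_pos, ?_⟩, rfl⟩, ?_⟩
    · rwa [mem_ball, dist_eq_norm]
    · simpa using hzR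
    · rintro a ⟨ha, q, ⟨hq1, hq2⟩, rfl⟩
      obtain ⟨s, hsc, hsf⟩ := hs _ ha
      refine ⟨insert q s, ?_, ?_⟩
      · rw [Finset.card_insert_of_notMem, hsc]
        intro hqs
        exact hq2 (by simpa using (hsf q hqs).1)
      · intro x hx
        rcases Finset.mem_insert.1 hx with rfl | hx
        · refine ⟨le_max_of_le_right ?_, rfl⟩
          rw [mem_ball, dist_eq_norm] at hq1
          have := norm_add_le z (x - z)
          rw [add_sub_cancel] at this
          linarith
        · exact ⟨le_max_of_le_left (hsf x hx).1, (hsf x hx).2⟩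

/-- The maximum modulus of a transcendental entire function eventually exceeds the radius. -/
theorem TranscendentalEntire.exists_norm_eq_le {f : ℂ → ℂ} (hf : TranscendentalEntire f) :
    ∀ᶠ s : ℝ in atTop, ∃ z : ℂ, ‖z‖ = s ∧ s ≤ ‖f z‖ := by
  by_contra hcon
  apply hf.2
  have hfreq : ∃ᶠ s : ℝ in atTop, ∀ z : ℂ, ‖z‖ = s → ‖f z‖ < s := by
    intro h
    apply hcon
    filter_upwards [h] with s hs
    push Not at hs
    exact hs
  have hb : ∀ w, ‖dslope f 0 w‖ ≤ 2 := by
    intro w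
    obtain ⟨s, hs, h1, h2⟩ := (hfreq.and_eventually
      ((eventually_gt_atTop ‖f 0‖).and (eventually_gt_atTop ‖w‖))).exists
    have hs0 : 0 < s := (norm_nonneg _).trans_lt h2
    refine Complex.norm_le_of_forall_mem_frontier_norm_le (U := ball (0 : ℂ) s) isBounded_ball
      (differentiable_dslope hf.1 0).diffContOnCl (fun z hz => ?_)
      (subset_closure (mem_ball_zero_iff.2 h2))
    rw [frontier_ball _ hs0.ne', mem_sphere_zero_iff_norm] at hz
    refine (norm_dslope_le (norm_pos_iff.1 (by linarith))).trans ?_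
    rw [sub_zero, hz, div_le_iff₀ hs0]
    linarith [hs z hz]
  refine exists_polynomial_of_norm_le 1 hf.1 (C := ‖f 0‖ + 2) fun w => ?_
  rw [eq_add_mul_dslope f 0 w, sub_zero]
  refine (norm_add_le _ _).trans ?_
  rw [norm_mul]
  nlinarith [hb w, norm_nonneg w, norm_nonneg (f 0), mul_nonneg (norm_nonneg w) (norm_nonneg (f 0)), mul_le_mul_of_nonneg_left (hb w) (norm_nonneg w)]

/-- A holomorphic function whose logarithmic derivative is bounded on a convex set varies at most
exponentially there. -/
theorem norm_le_exp_mul_of_norm_deriv_le {h : ℂ → ℂ} {S : Set ℂ} (hS : Convex ℝ S)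
    (hd : ∀ z ∈ S, DifferentiableAt ℂ h z) {C : ℝ} (hC : ∀ z ∈ S, ‖deriv h z‖ ≤ C * ‖h z‖)
    {x y : ℂ} (hx : x ∈ S) (hy : y ∈ S) : ‖h x‖ ≤ ‖h y‖ * Real.exp (C * ‖x - y‖) := by
  have hmem : ∀ t ∈ Icc (0 : ℝ) 1, y + (t : ℂ) * (x - y) ∈ S := by
    intro t ht
    have := hS.add_smul_sub_mem hy hx ht
    rwa [Complex.real_smul] at this
  have hder : ∀ t ∈ Icc (0 : ℝ) 1, HasDerivAt (fun t : ℝ => h (y + (t : ℂ) * (x - y)))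
      (deriv h (y + (t : ℂ) * (x - y)) * (x - y)) t := by
    intro t ht
    have h1 : HasDerivAt (fun t : ℝ => y + (t : ℂ) * (x - y)) (x - y) t := by
      simpa using ((Complex.ofRealCLM.hasDerivAt (x := t)).mul_const (x - y)).const_add y
    exact (hd _ (hmem t ht)).hasDerivAt.comp t h1
  have := norm_le_gronwallBound_of_norm_deriv_right_le
    (f := fun t : ℝ => h (y + (t : ℂ) * (x - y))) (a := 0) (b := 1)
    (δ := ‖h y‖) (K := C * ‖x - y‖) (ε := 0)
    (fun t ht => (hder t ht).continuousAt.continuousWithinAt)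
    (fun t ht => (hder t (Ico_subset_Icc_self ht)).hasDerivWithinAt) (by simp)
    (fun t ht => ?_) 1 (by simp)
  · simpa [gronwallBound_ε0] using this
  · rw [norm_mul, add_zero]
    calc _ ≤ C * ‖h (y + (t : ℂ) * (x - y))‖ * ‖x - y‖ := by
          gcongr
          exact hC _ (hmem t (Ico_subset_Icc_self ht))
      _ = _ := by ring

/-- Comparability of the values on `S` with the value at `p`, for all holomorphic functions on `U`
with bounded logarithmic derivative on a suitable compact set. -/
def HarnackBound (U : Set ℂ) (p : ℂ) (S : Set ℂ) : Prop :=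
  ∃ K ⊆ U, IsCompact K ∧ ∀ C : ℝ, ∃ C' : ℝ, 0 ≤ C' ∧ ∀ h : ℂ → ℂ, DifferentiableOn ℂ h U →
    (∀ z ∈ K, ‖deriv h z‖ ≤ C * ‖h z‖) → ∀ x ∈ S, ‖h p‖ ≤ C' * ‖h x‖ ∧ ‖h x‖ ≤ C' * ‖h p‖

theorem harnackBound_closedBall {U : Set ℂ} (hU : IsOpen U) {p : ℂ} {r : ℝ} (hr : 0 ≤ r)
    (hp : closedBall p r ⊆ U) : HarnackBound U p (closedBall p r) := by
  refine ⟨_, hp, isCompact_closedBall p r, fun C => ⟨Real.exp (|C| * r), (Real.exp_pos _).le,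
    fun h hh hC x hx => ?_⟩⟩
  have hd : ∀ z ∈ closedBall p r, DifferentiableAt ℂ h z := fun z hz =>
    hh.differentiableAt (hU.mem_nhds (hp hz))
  have hpm : p ∈ closedBall p r := mem_closedBall_self hr
  have h1 := norm_le_exp_mul_of_norm_deriv_le (convex_closedBall p r) hd hC hx hpm
  have h2 := norm_le_exp_mul_of_norm_deriv_le (convex_closedBall p r) hd hC hpm hx
  rw [norm_sub_rev] at h2
  rw [mem_closedBall, dist_eq_norm] at hx
  have h3 : Real.exp (C * ‖x - p‖) ≤ Real.exp (|C| * r) := by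
    gcongr
    exact le_abs_self C
  constructor
  · rw [mul_comm]
    exact h2.trans (by gcongr)
  · rw [mul_comm]
    exact h1.trans (by gcongr)

theorem HarnackBound.trans {U : Set ℂ} {p q : ℂ} {S : Set ℂ} (h1 : HarnackBound U p {q})
    (h2 : HarnackBound U q S) : HarnackBound U p S := by
  obtain ⟨K, hKU, hK, hKC⟩ := h1
  obtain ⟨L, hLU, hL, hLC⟩ := h2
  refine ⟨K ∪ L, union_subset hKU hLU, hK.union hL, fun C => ?_⟩
  obtain ⟨a, ha, ha'⟩ := hKC C
  obtain ⟨b, hb, hb'⟩ := hLC C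
  refine ⟨a * b, mul_nonneg ha hb, fun h hh hC x hx => ?_⟩
  obtain ⟨h3, h4⟩ := ha' h hh (fun z hz => hC z (Or.inl hz)) q rfl
  obtain ⟨h5, h6⟩ := hb' h hh (fun z hz => hC z (Or.inr hz)) x hx
  constructor
  · calc ‖h p‖ ≤ a * ‖h q‖ := h3
      _ ≤ a * (b * ‖h x‖) := by gcongr
      _ = _ := by ring
  · calc ‖h x‖ ≤ b * ‖h q‖ := h6
      _ ≤ b * (a * ‖h p‖) := by gcongr
      _ = _ := by ring

theorem HarnackBound.symm {U : Set ℂ} {p q : ℂ} (h1 : HarnackBound U p {q}) :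
    HarnackBound U q {p} := by
  obtain ⟨K, hKU, hK, hKC⟩ := h1
  refine ⟨K, hKU, hK, fun C => ?_⟩
  obtain ⟨a, ha, ha'⟩ := hKC C
  refine ⟨a, ha, fun h hh hC x hx => ?_⟩
  obtain rfl := mem_singleton_iff.1 hx
  exact (ha' h hh hC q rfl).symm

theorem HarnackBound.mono {U : Set ℂ} {p : ℂ} {S T : Set ℂ} (hST : S ⊆ T)
    (h1 : HarnackBound U p T) : HarnackBound U p S := by
  obtain ⟨K, hKU, hK, hKC⟩ := h1
  refine ⟨K, hKU, hK, fun C => ?_⟩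
  obtain ⟨a, ha, ha'⟩ := hKC C
  exact ⟨a, ha, fun h hh hC x hx => ha' h hh hC x (hST hx)⟩

theorem HarnackBound.union {U : Set ℂ} {p : ℂ} {S T : Set ℂ} (h1 : HarnackBound U p S)
    (h2 : HarnackBound U p T) : HarnackBound U p (S ∪ T) := by
  obtain ⟨K, hKU, hK, hKC⟩ := h1
  obtain ⟨L, hLU, hL, hLC⟩ := h2
  refine ⟨K ∪ L, union_subset hKU hLU, hK.union hL, fun C => ?_⟩
  obtain ⟨a, ha, ha'⟩ := hKC C
  obtain ⟨b, hb, hb'⟩ := hLC C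
  refine ⟨max a b, le_max_of_le_left ha, fun h hh hC x hx => ?_⟩
  rcases hx with hx | hx
  · obtain ⟨h3, h4⟩ := ha' h hh (fun z hz => hC z (Or.inl hz)) x hx
    constructor
    · exact h3.trans (by gcongr; exact le_max_left _ _)
    · exact h4.trans (by gcongr; exact le_max_left _ _)
  · obtain ⟨h3, h4⟩ := hb' h hh (fun z hz => hC z (Or.inr hz)) x hx
    constructor
    · exact h3.trans (by gcongr; exact le_max_right _ _)
    · exact h4.trans (by gcongr; exact le_max_right _ _)

/-- Harnack's inequality on compact subsets of a domain. -/
theorem harnackBound_of_isCompact {U : Set ℂ} (hU : IsOpen U) (hc : IsPreconnected U) {p : ℂ}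
    (hp : p ∈ U) {S : Set ℂ} (hS : IsCompact S) (hSU : S ⊆ U) : HarnackBound U p S := by
  have hnh : ∀ z ∈ U, ∃ r > 0, HarnackBound U z (Metric.closedBall z r) := by
    intro z hz
    obtain ⟨r, hr, hr'⟩ := Metric.nhds_basis_closedBall.mem_iff.1 (hU.mem_nhds hz)
    exact ⟨r, hr, harnackBound_closedBall hU hr.le hr'⟩
  have hpair : ∀ z ∈ U, HarnackBound U p {z} := by
    intro z hz
    refine hc.induction₂ (fun x y => HarnackBound U x {y}) (fun x hx => ?_)
      (fun x y z _ _ _ h1 h2 => h1.trans h2) (fun x y _ _ h => h.symm) hp hz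
    obtain ⟨r, hr, hr'⟩ := hnh x hx
    filter_upwards [mem_nhdsWithin_of_mem_nhds (closedBall_mem_nhds x hr)] with y hy
    exact hr'.mono (singleton_subset_iff.2 hy)
  refine hS.induction_on ?_ (fun s t hst ht => ht.mono hst) (fun s t hs ht => hs.union ht) ?_
  · exact (hpair p hp).mono (empty_subset _)
  · intro z hz
    obtain ⟨r, hr, hball⟩ := hnh z (hSU hz)
    exact ⟨_, mem_nhdsWithin_of_mem_nhds (closedBall_mem_nhds z hr), (hpair z (hSU hz)).trans hball⟩

/-- A zero-free function with large logarithmic derivative covers a thick annulus. -/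
theorem mem_image_of_abs_log_sub_lt {h : ℂ → ℂ} {z : ℂ} {δ δ' : ℝ} (hδ : 0 < δ) (hδ' : δ < δ')
    (hd : DifferentiableOn ℂ h (ball z δ')) (h0 : ∀ w ∈ ball z δ', h w ≠ 0) :
    ∃ z₁ ∈ closedBall z δ, ∀ w : ℂ, w ≠ 0 →
      |Real.log ‖w‖ - Real.log ‖h z₁‖| < δ * (‖deriv h z‖ / ‖h z‖) / 48 - 4 →
        w ∈ h '' closedBall z δ := by
  have hzm : z ∈ ball z δ' := mem_ball_self (hδ.trans hδ')
  obtain ⟨G, hGz, hG⟩ := ((hd.deriv isOpen_ball).div hd h0).isExactOn_ball.with_val_at z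
    (Complex.log (h z))
  have hGd : DifferentiableOn ℂ G (ball z δ') := fun w hw =>
    (hG w hw).differentiableAt.differentiableWithinAt
  have hexp : ∀ w ∈ ball z δ', h w = Complex.exp (G w) := by
    intro w hw
    have hder : ∀ x ∈ ball z δ', HasDerivAt (fun w => h w * Complex.exp (-G w)) 0 x := by
      intro x hx
      have h1 := (hd.differentiableAt (isOpen_ball.mem_nhds hx)).hasDerivAt.mul (hG x hx).neg.cexp
      refine h1.congr_deriv ?_
      have := h0 x hx
      simp only [Pi.div_apply, Pi.neg_apply]
      field_simp
      ring
    have h2 := isOpen_ball.is_const_of_deriv_eq_zero (convex_ball z δ').isPreconnected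
      (fun x hx => (hder x hx).differentiableAt.differentiableWithinAt)
      (fun x hx => (hder x hx).deriv) hw hzm
    simp only [hGz] at h2
    rw [Complex.exp_neg, Complex.exp_neg, Complex.exp_log (h0 z hzm), mul_inv_cancel₀ (h0 z hzm)]
      at h2
    exact (mul_inv_eq_one₀ (Complex.exp_ne_zero _)).1 h2
  have hsub : closedBall z δ ⊆ ball z δ' := closedBall_subset_ball hδ'
  obtain ⟨z₁, hz₁, hb⟩ := exists_ball_subset_image isOpen_ball hGd hδ hsub
  refine ⟨z₁, hz₁, fun w hw hlt => ?_⟩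
  have hz₁0 := h0 z₁ (hsub hz₁)
  have hmem : G z₁ + Complex.log (w / h z₁) ∈ ball (G z₁) (δ * ‖deriv G z‖ / 48) := by
    rw [mem_ball, dist_eq_norm, add_sub_cancel_left, (hG z hzm).deriv, Pi.div_apply, norm_div]
    refine (Complex.norm_le_abs_re_add_abs_im _).trans_lt ?_
    rw [Complex.log_re, Complex.log_im, norm_div, Real.log_div (norm_ne_zero_iff.2 hw)
      (norm_ne_zero_iff.2 hz₁0)]
    linarith [Complex.abs_arg_le_pi (w / h z₁), Real.pi_le_four]
  obtain ⟨x, hx, hxe⟩ := hb hmem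
  refine ⟨x, hx, ?_⟩
  rw [hexp x (hsub hx), hxe, Complex.exp_add, ← hexp _ (hsub hz₁),
    Complex.exp_log (div_ne_zero hw hz₁0), mul_div_cancel₀ _ hz₁0]

/-- Dividing out finitely many zeros of an entire function. -/
theorem exists_eq_mul_prod_sub {g : ℂ → ℂ} (hg : Differentiable ℂ g) (s : Finset ℂ)
    (hs : ∀ q ∈ s, g q = 0) :
    ∃ Q : ℂ → ℂ, Differentiable ℂ Q ∧ ∀ w, g w = Q w * ∏ q ∈ s, (w - q) := by
  induction s using Finset.induction_on with
  | empty => exact ⟨g, hg, by simp⟩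
  | insert q s hq ih =>
    obtain ⟨Q, hQ, hgQ⟩ := ih fun x hx => hs x (Finset.mem_insert_of_mem hx)
    have hQq : Q q = 0 := by
      have h1 := hs q (Finset.mem_insert_self q s)
      rw [hgQ q] at h1
      refine (mul_eq_zero.1 h1).resolve_right (Finset.prod_ne_zero_iff.2 fun x hx => ?_)
      exact sub_ne_zero.2 fun h => hq (h ▸ hx)
    refine ⟨dslope Q q, differentiable_dslope hQ q, fun w => ?_⟩
    rw [hgQ w, Finset.prod_insert hq, eq_add_mul_dslope Q q w, hQq]
    ring

/-- A function of the form `g ∘ h` is small where `h` is small if `g` has many zeros. -/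
theorem norm_comp_le_of_zeros {g h : ℂ → ℂ} (hg : Differentiable ℂ g) (hh : Differentiable ℂ h)
    {D : Set ℂ} (hb : Bornology.IsBounded D) {T A : ℝ} (hT : 0 < T) (hA : 0 ≤ A) {s : Finset ℂ}
    (hs : ∀ q ∈ s, ‖q‖ < T ∧ g q = 0) (hfr : ∀ z ∈ frontier D, 8 * T ≤ ‖h z‖ ∧ ‖g (h z)‖ ≤ A)
    {w : ℂ} (hw : w ∈ D) (hhw : ‖h w‖ < 2 * T) : ‖g (h w)‖ ≤ A * (3 / 7) ^ s.card := by
  obtain ⟨Q, hQ, hgQ⟩ := exists_eq_mul_prod_sub hg s fun q hq => (hs q hq).2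
  have h1 : ‖Q (h w)‖ ≤ A / (7 * T) ^ s.card := by
    refine Complex.norm_le_of_forall_mem_frontier_norm_le (f := fun z => Q (h z)) hb
      (hQ.comp hh).diffContOnCl (fun z hz => ?_) (subset_closure hw)
    rw [le_div_iff₀ (by positivity)]
    refine le_trans ?_ (hfr z hz).2
    rw [hgQ, norm_mul, norm_prod]
    gcongr
    rw [← Finset.prod_const]
    refine Finset.prod_le_prod (fun q _ => by positivity) fun q hq => ?_
    have h2 := (hfr z hz).1
    have h3 := (hs q hq).1
    have h4 := norm_sub_norm_le (h z) q
    linarith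
  have h2 : ‖∏ q ∈ s, (h w - q)‖ ≤ (3 * T) ^ s.card := by
    rw [norm_prod]
    rw [← Finset.prod_const]
    refine Finset.prod_le_prod (fun q _ => by positivity) fun q hq => ?_
    have h3 := (hs q hq).1
    have h4 := norm_sub_le (h w) q
    linarith
  rw [hgQ, norm_mul]
  calc _ ≤ A / (7 * T) ^ s.card * (3 * T) ^ s.card := by gcongr
    _ = A * (3 / 7) ^ s.card := by
      rw [mul_pow, mul_pow, div_pow]
      field_simp

/-- A crude version of the three circles theorem. -/
theorem norm_le_max_mul_pow {h : ℂ → ℂ} (hh : Differentiable ℂ h) {c : ℂ} {a b η C : ℝ}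
    (ha : 0 < a) (hη : ∀ z, ‖z - c‖ = a → ‖h z‖ ≤ η) (hC : ∀ z, ‖z - c‖ = b → ‖h z‖ ≤ C)
    (k : ℕ) {w : ℂ} (hw : a ≤ ‖w - c‖) (hwb : ‖w - c‖ ≤ b) :
    ‖h w‖ ≤ max (η / a ^ k) (C / b ^ k) * ‖w - c‖ ^ k := by
  rcases hw.eq_or_lt with hwa | hwa
  · refine (hη w hwa.symm).trans ?_
    rw [← hwa]
    calc η = η / a ^ k * a ^ k := by field_simp
      _ ≤ _ := by gcongr; exact le_max_left _ _
  rcases hwb.eq_or_lt with hwb | hwb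
  · refine (hC w hwb).trans ?_
    have hb : 0 < b := by linarith
    rw [hwb]
    calc C = C / b ^ k * b ^ k := by field_simp
      _ ≤ _ := by gcongr; exact le_max_right _ _
  have hb : 0 < b := by linarith
  set O : Set ℂ := {z | a < ‖z - c‖ ∧ ‖z - c‖ < b} with hO
  have hcn : Continuous fun z : ℂ => ‖z - c‖ := by fun_prop
  have hcl : closure O ⊆ {z | a ≤ ‖z - c‖ ∧ ‖z - c‖ ≤ b} := by
    refine closure_minimal (fun z hz => ⟨hz.1.le, hz.2.le⟩) ?_
    exact (isClosed_le continuous_const hcn).inter (isClosed_le hcn continuous_const)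
  have hOo : IsOpen O := (isOpen_lt continuous_const hcn).inter (isOpen_lt hcn continuous_const)
  have hne : ∀ z ∈ closure O, z - c ≠ 0 := fun z hz =>
    norm_pos_iff.1 (ha.trans_le (hcl hz).1)
  have hbd : Bornology.IsBounded O := (isBounded_ball (x := c) (r := b)).subset fun z hz => by
    rw [mem_ball, dist_eq_norm]; exact hz.2
  have key : ‖h w / (w - c) ^ k‖ ≤ max (η / a ^ k) (C / b ^ k) := by
    refine Complex.norm_le_of_forall_mem_frontier_norm_le (f := fun z => h z / (z - c) ^ k) hbd
      ?_ (fun z hz => ?_) (subset_closure ⟨hwa, hwb⟩)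
    · refine DifferentiableOn.diffContOnCl ?_
      intro z hz
      have h1 : DifferentiableAt ℂ (fun z => (z - c) ^ k) z := by fun_prop
      exact ((hh z).fun_div h1 (pow_ne_zero k (hne z hz))).differentiableWithinAt
    · have h1 := hcl (frontier_subset_closure hz)
      rw [hOo.frontier_eq] at hz
      rw [norm_div, norm_pow]
      rcases h1.1.eq_or_lt with h2 | h2
      · rw [← h2]
        refine le_trans ?_ (le_max_left _ _)
        gcongr
        exact hη z h2.symm
      · have h3 : ‖z - c‖ = b := by
          refine le_antisymm h1.2 (not_lt.1 fun h3 => hz.2 ⟨h2, h3⟩)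
        rw [h3]
        refine le_trans ?_ (le_max_right _ _)
        gcongr
        exact hC z h3
  rwa [norm_div, norm_pow, div_le_iff₀ (pow_pos (by linarith) k)] at key

/-- Relative smallness of a sequence of entire functions in an open set propagates to the
boundary. -/
theorem exists_mem_frontier_small {F : ℕ → ℂ → ℂ} (hF : ∀ n, Differentiable ℂ (F n)) {D : Set ℂ}
    (hD : IsOpen D) (hb : Bornology.IsBounded D) {M : ℕ → ℝ} {l : Filter ℕ} {C : ℝ}
    (hM : ∀ᶠ n in l, 0 < M n)
    (hC : ∀ᶠ n in l, ∀ z ∈ frontier D, ‖F n z‖ ≤ C * M n) {W : Set ℂ} (hW : IsOpen W)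
    (hW' : W.Nonempty) (hWD : W ⊆ D)
    (hsmall : ∀ ε > 0, ∀ᶠ n in l, ∀ z ∈ W, ‖F n z‖ ≤ ε * M n) :
    ∃ p ∈ frontier D, ∀ V ∈ 𝓝 p, ∃ z ∈ V, ∀ ε > 0, ∀ᶠ n in l, ‖F n z‖ ≤ ε * M n := by
  set A : Set ℂ := {z | ∃ r > 0, ball z r ⊆ D ∧
    ∀ ε > 0, ∀ᶠ n in l, ∀ w ∈ ball z r, ‖F n w‖ ≤ ε * M n} with hA
  have hAD : A ⊆ D := fun z ⟨r, hr, h, _⟩ => h (mem_ball_self hr)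
  have hWA : W ⊆ A := by
    intro z hz
    obtain ⟨r, hr, hr'⟩ := Metric.isOpen_iff.1 hW z hz
    refine ⟨r, hr, hr'.trans hWD, fun ε hε => ?_⟩
    filter_upwards [hsmall ε hε] with n hn w hw using hn w (hr' hw)
  have hCD : ∀ᶠ n in l, ∀ z ∈ D, ‖F n z‖ ≤ C * M n := by
    filter_upwards [hC] with n hn z hz
    exact Complex.norm_le_of_forall_mem_frontier_norm_le hb (hF n).diffContOnCl hn
      (subset_closure hz)
  have hclosed : D ∩ closure A ⊆ A := by
    rintro z ⟨hzD, hzA⟩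
    obtain ⟨R, hR, hRD⟩ := Metric.isOpen_iff.1 hD z hzD
    set ρ := R / 10 with hρ
    have hρ0 : 0 < ρ := by positivity
    obtain ⟨z', ⟨r, hr, hrD, hrs⟩, hzz'⟩ := Metric.mem_closure_iff.1 hzA ρ hρ0
    set a := min (r / 2) ρ with ha
    have ha0 : 0 < a := by positivity
    have har : a < r := (min_le_left _ _).trans_lt (half_lt_self hr)
    have haρ : a ≤ ρ := min_le_right _ _
    refine ⟨ρ, hρ0, (ball_subset_ball (by rw [hρ]; linarith)).trans hRD, fun ε hε => ?_⟩
    obtain ⟨k, hk⟩ := exists_pow_lt_of_lt_one (y := (2 / 3 : ℝ)) (x := ε / (|C| + 1)) (by positivity)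
      (by norm_num)
    set η := ε * (a / (2 * ρ)) ^ k with hη
    have hη0 : 0 < η := by positivity
    have hηε : η ≤ ε := by
      refine mul_le_of_le_one_right hε.le (pow_le_one₀ (by positivity) ?_)
      rw [div_le_one (by positivity)]
      linarith
    filter_upwards [hrs η hη0, hCD, hM] with n h1 h2 h3 w hw
    have hwz : ‖w - z'‖ ≤ 2 * ρ := by
      rw [mem_ball] at hw
      rw [← dist_eq_norm]
      linarith [dist_triangle w z z']
    rcases le_or_gt a ‖w - z'‖ with h4 | h4
    · have h5 := norm_le_max_mul_pow (hF n) (c := z') (a := a) (b := 3 * ρ) (η := η * M n)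
        (C := |C| * M n) ha0 (fun x hx => h1 x ?_) (fun x hx => (h2 x (hRD ?_)).trans ?_) k h4
        (by linarith)
      · refine h5.trans ?_
        calc _ ≤ max (η * M n / a ^ k) (|C| * M n / (3 * ρ) ^ k) * (2 * ρ) ^ k := by
              gcongr
          _ ≤ ε * M n := by
            rw [← le_div_iff₀ (by positivity)]
            refine max_le (le_of_eq ?_) ?_
            · rw [hη, div_pow]
              field_simp
            · rw [div_le_div_iff₀ (by positivity) (by positivity)]
              rw [lt_div_iff₀ (by positivity)] at hk
              have h6 : (2 * ρ) ^ k = (2 / 3) ^ k * (3 * ρ) ^ k := by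
                rw [← mul_pow]; congr 1; ring
              rw [h6]
              have h7 : (2 / 3 : ℝ) ^ k * |C| ≤ ε := by
                nlinarith [pow_pos (by norm_num : (0 : ℝ) < 2 / 3) k]
              calc _ = (2 / 3 : ℝ) ^ k * |C| * (M n * (3 * ρ) ^ k) := by ring
                _ ≤ ε * (M n * (3 * ρ) ^ k) := by gcongr
                _ = _ := by ring
      · rw [mem_ball, dist_eq_norm, hx]; exact har
      · rw [mem_ball]
        rw [← dist_eq_norm] at hx
        rw [dist_comm] at hzz'
        linarith [dist_triangle x z' z]
      · gcongr
        exact le_abs_self C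
    · refine (h1 w ?_).trans (by gcongr)
      rw [mem_ball, dist_eq_norm]
      exact h4.trans har
  have hAo : IsOpen A := by
    rw [Metric.isOpen_iff]
    rintro z ⟨r, hr, hrD, hrs⟩
    refine ⟨r / 2, by positivity, fun z' hz' => ⟨r / 2, by positivity, ?_, fun ε hε => ?_⟩⟩
    all_goals
      have hsub : ball z' (r / 2) ⊆ ball z r := by
        refine ball_subset_ball' ?_
        rw [mem_ball] at hz'
        linarith
    · exact hsub.trans hrD
    · filter_upwards [hrs ε hε] with n hn w hw using hn w (hsub hw)
  have hfr : (frontier A).Nonempty := by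
    refine nonempty_frontier_iff.2 ⟨hW'.mono hWA, ?_⟩
    intro h
    exact NormedSpace.unbounded_univ ℂ ℂ (h ▸ hb.subset hAD)
  obtain ⟨p, hp⟩ := hfr
  rw [hAo.frontier_eq] at hp
  refine ⟨p, ?_, fun V hV => ?_⟩
  · rw [hD.frontier_eq]
    exact ⟨closure_mono hAD hp.1, fun h => hp.2 (hclosed ⟨h, hp.1⟩)⟩
  · obtain ⟨z, hzV, r, hr, -, hz⟩ := mem_closure_iff_nhds.1 hp.1 V hV
    refine ⟨z, hzV, fun ε hε => ?_⟩
    filter_upwards [hz ε hε] with n hn using hn z (mem_ball_self hr)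

/-- Stereographic projection of the Riemann sphere. -/
noncomputable def stereo : Option ℂ → WithLp 2 (ℂ × ℝ)
  | none => WithLp.toLp 2 (0, 1)
  | some z => WithLp.toLp 2 (((2 / (1 + ‖z‖ ^ 2) : ℝ) : ℂ) * z, 1 - 2 / (1 + ‖z‖ ^ 2))

theorem chordalDist_nonneg (a b : Option ℂ) : 0 ≤ chordalDist a b := by
  cases a <;> cases b <;> simp only [chordalDist] <;> positivity

theorem sq_dist_toLp (a b : ℂ) (x y : ℝ) :
    dist (WithLp.toLp 2 (a, x)) (WithLp.toLp 2 (b, y)) ^ 2 = ‖a - b‖ ^ 2 + (x - y) ^ 2 := by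
  rw [dist_eq_norm, WithLp.prod_norm_sq_eq_of_L2]
  change ‖a - b‖ ^ 2 + ‖x - y‖ ^ 2 = _
  rw [Real.norm_eq_abs, sq_abs]

theorem sq_dist_stereo_none (z : ℂ) :
    dist (stereo (some z)) (stereo none) ^ 2 = (2 / Real.sqrt (1 + ‖z‖ ^ 2)) ^ 2 := by
  have h : (0 : ℝ) < 1 + ‖z‖ ^ 2 := by positivity
  simp only [stereo, sq_dist_toLp, sub_zero, norm_mul, Complex.norm_real, Real.norm_eq_abs, sq_abs,
    mul_pow, div_pow, Real.sq_sqrt h.le]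
  field_simp
  ring

theorem dist_stereo (a b : Option ℂ) : dist (stereo a) (stereo b) = chordalDist a b := by
  rw [← sq_eq_sq₀ dist_nonneg (chordalDist_nonneg a b)]
  rcases a with _ | z <;> rcases b with _ | w
  · simp [chordalDist]
  · rw [dist_comm, sq_dist_stereo_none, chordalDist]
  · rw [sq_dist_stereo_none, chordalDist]
  · have h : (0 : ℝ) < 1 + ‖z‖ ^ 2 := by positivity
    have h' : (0 : ℝ) < 1 + ‖w‖ ^ 2 := by positivity
    simp only [stereo, chordalDist, sq_dist_toLp, mul_pow, div_pow, Real.sq_sqrt h.le,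
      Real.sq_sqrt h'.le]
    simp only [Complex.sq_norm, Complex.normSq_apply] at h h' ⊢
    simp only [Complex.sub_re, Complex.sub_im, Complex.re_ofReal_mul, Complex.im_ofReal_mul]
    field_simp
    ring

theorem continuous_stereo : Continuous fun z : ℂ => stereo (some z) := by
  have h : ∀ z : ℂ, (1 : ℝ) + ‖z‖ ^ 2 ≠ 0 := fun z => by positivity
  simp only [stereo]
  refine (WithLp.prod_continuous_toLp 2 ℂ ℝ).comp ?_
  have h1 : Continuous fun z : ℂ => 2 / (1 + ‖z‖ ^ 2) :=
    continuous_const.div (by fun_prop) h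
  exact ((Complex.continuous_ofReal.comp h1).mul continuous_id).prodMk (continuous_const.sub h1)

theorem abs_sub_le_dist_stereo (z w : ℂ) :
    |2 / (1 + ‖z‖ ^ 2) - 2 / (1 + ‖w‖ ^ 2)| ≤ dist (stereo (some z)) (stereo (some w)) := by
  refine abs_le_of_sq_le_sq ?_ dist_nonneg
  simp only [stereo, sq_dist_toLp]
  nlinarith [sq_nonneg ‖((2 / (1 + ‖z‖ ^ 2) : ℝ) : ℂ) * z - ((2 / (1 + ‖w‖ ^ 2) : ℝ) : ℂ) * w‖]

theorem dist_stereo_le (z w : ℂ) : dist (stereo (some z)) (stereo (some w)) ≤ 2 * ‖z - w‖ := by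
  rw [dist_stereo, chordalDist]
  refine div_le_self (by positivity) ?_
  have h : ∀ z : ℂ, 1 ≤ Real.sqrt (1 + ‖z‖ ^ 2) := fun z =>
    Real.one_le_sqrt.2 (by nlinarith [norm_nonneg z])
  nlinarith [h z, h w]

theorem dist_stereo_inv {z w : ℂ} (hz : z ≠ 0) (hw : w ≠ 0) :
    dist (stereo (some z⁻¹)) (stereo (some w⁻¹)) = dist (stereo (some z)) (stereo (some w)) := by
  rw [dist_stereo, dist_stereo, chordalDist, chordalDist]
  have h : ∀ z : ℂ, z ≠ 0 → Real.sqrt (1 + ‖z⁻¹‖ ^ 2) = Real.sqrt (1 + ‖z‖ ^ 2) / ‖z‖ := by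
    intro z hz
    have hz0 : 0 < ‖z‖ := norm_pos_iff.2 hz
    rw [Real.sqrt_eq_iff_mul_self_eq (by positivity) (by positivity), div_mul_div_comm,
      Real.mul_self_sqrt (by positivity), norm_inv]
    field_simp
    ring
  have hz0 : 0 < ‖z‖ := norm_pos_iff.2 hz
  have hw0 : 0 < ‖w‖ := norm_pos_iff.2 hw
  have h2 : ‖z⁻¹ - w⁻¹‖ = ‖z - w‖ / (‖z‖ * ‖w‖) := by
    rw [inv_sub_inv hz hw, norm_div, norm_mul, norm_sub_rev]
  rw [h z hz, h w hw, h2]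
  field_simp

theorem isOpen_fatouSet (f : ℂ → ℂ) : IsOpen (fatouSet f) := by
  rw [isOpen_iff_mem_nhds]
  rintro z ⟨V, hV, h⟩
  filter_upwards [eventually_mem_nhds_iff.2 hV] with w hw using ⟨V, hw, h⟩

theorem mapsTo_fatouSet {f : ℂ → ℂ} (ho : IsOpenMap f) :
    MapsTo f (fatouSet f) (fatouSet f) := by
  rintro z ⟨V, hV, h⟩
  obtain ⟨r, hr, hrV⟩ := Metric.nhds_basis_closedBall.mem_iff.1 hV
  refine ⟨f '' closedBall z r, mem_of_superset ((ho _ isOpen_ball).mem_nhds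
    (mem_image_of_mem f (mem_ball_self hr))) (image_mono ball_subset_closedBall), fun φ hφ => ?_⟩
  obtain ⟨ψ, hψ, g, hg⟩ := h (fun n => φ n + 1) (fun m n hmn => Nat.succ_lt_succ (hφ hmn))
  choose! v hv hfv using fun y (hy : y ∈ f '' closedBall z r) => hy
  refine ⟨ψ, hψ, fun y => g (v y), fun K hK hKc ε hε => ?_⟩
  filter_upwards [hg _ hrV (isCompact_closedBall z r) ε hε] with n hn y hy
  have := hn (v y) (hv y (hK hy))
  rwa [Function.iterate_succ_apply, hfv y (hK hy)] at this

/-- The iterates are spherically equicontinuous at points of the Fatou set. -/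
theorem exists_forall_dist_stereo_iterate_lt {f : ℂ → ℂ} (hf : Continuous f) {z : ℂ}
    (hz : z ∈ fatouSet f) {ε : ℝ} (hε : 0 < ε) :
    ∃ r > 0, ∀ n, ∀ w ∈ ball z r, dist (stereo (some (f^[n] w))) (stereo (some (f^[n] z))) < ε := by
  obtain ⟨V, hV, h⟩ := hz
  have hcont : ∀ n, Continuous fun w => stereo (some (f^[n] w)) := fun n =>
    continuous_stereo.comp (hf.iterate n)
  have hsing : ∀ n, ∃ r > 0, ∀ w ∈ ball z r,
      dist (stereo (some (f^[n] w))) (stereo (some (f^[n] z))) < ε := fun n => by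
    obtain ⟨r, hr, h⟩ := Metric.continuous_iff.1 (hcont n) z ε hε
    exact ⟨r, hr, fun w hw => h w hw⟩
  have hlarge : ∃ r > 0, ∀ᶠ n in atTop, ∀ w ∈ ball z r,
      dist (stereo (some (f^[n] w))) (stereo (some (f^[n] z))) < ε := by
    by_contra hcon
    have hbad : ∀ k : ℕ, ∃ᶠ n in atTop, ∃ w ∈ ball z (1 / (k + 1 : ℝ)),
        ε ≤ dist (stereo (some (f^[n] w))) (stereo (some (f^[n] z))) := by
      intro k hk
      refine hcon ⟨1 / (k + 1 : ℝ), by positivity, ?_⟩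
      filter_upwards [hk] with n hn w hw
      by_contra hc
      exact hn ⟨w, hw, not_lt.1 hc⟩
    obtain ⟨φ, hφ, hφ'⟩ := extraction_forall_of_frequently hbad
    obtain ⟨ψ, hψ, g, hg⟩ := h φ hφ
    obtain ⟨r, hr, hrV⟩ := Metric.nhds_basis_closedBall.mem_iff.1 hV
    have hunif := hg _ hrV (isCompact_closedBall z r)
    have hu : TendstoUniformlyOn (fun n w => stereo (some (f^[φ (ψ n)] w)))
        (fun w => stereo (g w)) atTop (closedBall z r) := by
      rw [Metric.tendstoUniformlyOn_iff]
      intro δ hδ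
      filter_upwards [hunif δ hδ] with n hn w hw
      rw [dist_comm, dist_stereo]
      exact hn w hw
    have hgc : ContinuousAt (fun w => stereo (g w)) z :=
      (hu.continuousOn (Frequently.of_forall fun n => (hcont _).continuousOn)).continuousAt
        (closedBall_mem_nhds z hr)
    obtain ⟨δ, hδ, hgδ⟩ := Metric.continuousAt_iff.1 hgc (ε / 3) (by positivity)
    have h1 := Metric.tendstoUniformlyOn_iff.1 hu (ε / 3) (by positivity)
    have h2 : ∀ᶠ n : ℕ in atTop, 1 / (ψ n + 1 : ℝ) < min δ r :=
      (tendsto_one_div_add_atTop_nhds_zero_nat.comp hψ.tendsto_atTop).eventually_lt_const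
        (lt_min hδ hr)
    obtain ⟨n, h3, h4⟩ := (h1.and h2).exists
    obtain ⟨w, hw, hwε⟩ := hφ' (ψ n)
    have hw' : dist w z < min δ r := (mem_ball.1 hw).trans h4
    have h5 := h3 w (hw'.le.trans (min_le_right _ _))
    have h6 := h3 z (mem_closedBall_self hr.le)
    have h7 := hgδ (hw'.trans_le (min_le_left _ _))
    have h8 := dist_triangle4 (stereo (some (f^[φ (ψ n)] w))) (stereo (g w)) (stereo (g z))
      (stereo (some (f^[φ (ψ n)] z)))
    rw [dist_comm] at h5
    linarith
  obtain ⟨r, hr, hl⟩ := hlarge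
  obtain ⟨N, hN⟩ := eventually_atTop.1 hl
  choose ρ hρ hρ' using hsing
  have : ∀ N : ℕ, ∃ s > 0, ∀ n < N, s ≤ ρ n := by
    intro N
    induction N with
    | zero => exact ⟨1, one_pos, by simp⟩
    | succ N ih =>
      obtain ⟨s, hs, h⟩ := ih
      refine ⟨min s (ρ N), lt_min hs (hρ N), fun n hn => ?_⟩
      rcases Nat.lt_succ_iff_lt_or_eq.1 hn with h1 | rfl
      · exact (min_le_left _ _).trans (h n h1)
      · exact min_le_right _ _
  obtain ⟨s, hs, hsN⟩ := this N
  refine ⟨min s r, lt_min hs hr, fun n w hw => ?_⟩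
  rcases lt_or_ge n N with hn | hn
  · exact hρ' n w (ball_subset_ball ((min_le_left _ _).trans (hsN n hn)) hw)
  · exact hN n hn w (ball_subset_ball (min_le_right _ _) hw)

theorem exists_pos_forall_lt {P : ℕ → ℝ → Prop} (hP : ∀ n s t, s ≤ t → P n t → P n s)
    (h : ∀ n, ∃ s > 0, P n s) (N : ℕ) : ∃ s > 0, ∀ n < N, P n s := by
  induction N with
  | zero => exact ⟨1, one_pos, by simp⟩
  | succ N ih =>
    obtain ⟨s, hs, hs'⟩ := ih
    obtain ⟨t, ht, ht'⟩ := h N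
    refine ⟨min s t, lt_min hs ht, fun n hn => ?_⟩
    rcases Nat.lt_succ_iff_lt_or_eq.1 hn with h1 | rfl
    · exact hP n _ _ (min_le_left _ _) (hs' n h1)
    · exact hP n _ _ (min_le_right _ _) ht'

theorem norm_sub_le_of_dist_stereo_le {z w : ℂ} {X d : ℝ} (hz : ‖z‖ ≤ X)
    (hd : dist (stereo (some z)) (stereo (some w)) ≤ d) (hdX : d * (1 + X) ≤ 1) :
    ‖z - w‖ ≤ d * (1 + X) ^ 2 := by
  have hX : 0 ≤ X := (norm_nonneg z).trans hz
  have hd0 : 0 ≤ d := dist_nonneg.trans hd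
  have hs : ∀ z : ℂ, Real.sqrt (1 + ‖z‖ ^ 2) ≤ 1 + ‖z‖ := fun z =>
    Real.sqrt_le_iff.2 ⟨by positivity, by nlinarith [norm_nonneg z]⟩
  rw [dist_stereo, chordalDist, div_le_iff₀ (by positivity)] at hd
  have h1 : d * (Real.sqrt (1 + ‖z‖ ^ 2) * Real.sqrt (1 + ‖w‖ ^ 2)) ≤
      d * ((1 + X) * (1 + X + ‖z - w‖)) := by
    have h2 := norm_sub_norm_le w z
    rw [norm_sub_rev] at h2
    gcongr
    · exact (hs z).trans (by linarith)
    · exact (hs w).trans (by linarith)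
  nlinarith [mul_le_mul_of_nonneg_right hdX (norm_nonneg (z - w))]

theorem exists_pos_norm_sub_lt (X : ℝ) {ε : ℝ} (hε : 0 < ε) : ∃ δ > 0, ∀ z w : ℂ, ‖z‖ ≤ X →
    dist (stereo (some z)) (stereo (some w)) < δ → ‖z - w‖ < ε := by
  rcases lt_or_ge X 0 with hX | hX
  · exact ⟨1, one_pos, fun z w hz _ => absurd (norm_nonneg z) (by linarith)⟩
  · refine ⟨min (1 / (1 + X)) (ε / 2 / (1 + X) ^ 2), by positivity, fun z w hz hd => ?_⟩
    refine (norm_sub_le_of_dist_stereo_le hz hd.le ?_).trans_lt ?_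
    · calc _ ≤ 1 / (1 + X) * (1 + X) := by gcongr; exact min_le_left _ _
        _ = 1 := by field_simp
    · calc _ ≤ ε / 2 / (1 + X) ^ 2 * (1 + X) ^ 2 := by gcongr; exact min_le_right _ _
        _ = ε / 2 := by field_simp
        _ < ε := half_lt_self hε

/-- The iterates of the points of `S` are eventually spherically close to those of `p`. -/
def IteratesClose (f : ℂ → ℂ) (p : ℂ) (S : Set ℂ) : Prop :=
  ∀ ε > 0, ∀ᶠ n in atTop, ∀ w ∈ S,
    dist (stereo (some (f^[n] w))) (stereo (some (f^[n] p))) < ε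

theorem IteratesClose.mono {f : ℂ → ℂ} {p : ℂ} {S T : Set ℂ} (hST : S ⊆ T)
    (h : IteratesClose f p T) : IteratesClose f p S := fun ε hε => by
  filter_upwards [h ε hε] with n hn w hw using hn w (hST hw)

theorem IteratesClose.union {f : ℂ → ℂ} {p : ℂ} {S T : Set ℂ} (hS : IteratesClose f p S)
    (hT : IteratesClose f p T) : IteratesClose f p (S ∪ T) := fun ε hε => by
  filter_upwards [hS ε hε, hT ε hε] with n h1 h2 w hw using hw.elim (h1 w) (h2 w)

theorem IteratesClose.symm {f : ℂ → ℂ} {p q : ℂ} (h : IteratesClose f p {q}) :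
    IteratesClose f q {p} := fun ε hε => by
  filter_upwards [h ε hε] with n hn w hw
  obtain rfl := mem_singleton_iff.1 hw
  rw [dist_comm]
  exact hn q rfl

theorem IteratesClose.trans {f : ℂ → ℂ} {p q : ℂ} {S : Set ℂ} (h : IteratesClose f p {q})
    (h' : IteratesClose f q S) : IteratesClose f p S := fun ε hε => by
  filter_upwards [h (ε / 2) (by positivity), h' (ε / 2) (by positivity)] with n h1 h2 w hw
  have h3 := h1 q rfl
  have h4 := h2 w hw
  linarith [dist_triangle (stereo (some (f^[n] w))) (stereo (some (f^[n] q)))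
    (stereo (some (f^[n] p)))]

theorem exists_iteratesClose_ball {f : ℂ → ℂ} (hf : Differentiable ℂ f) {U : Set ℂ}
    (hU : IsOpen U) (hUF : U ⊆ fatouSet f)
    (hdis : Pairwise fun m n => Disjoint (f^[m] '' U) (f^[n] '' U)) {z : ℂ} (hz : z ∈ U) :
    ∃ r > 0, IteratesClose f z (ball z r) := by
  obtain ⟨r₁, hr₁, heq⟩ := exists_forall_dist_stereo_iterate_lt hf.continuous (hUF hz)
    (ε := 1 / 3) (by norm_num)
  obtain ⟨r₂, hr₂, hrU⟩ := Metric.isOpen_iff.1 hU z hz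
  have hsq : ∀ a : ℂ, 0 < 1 + ‖a‖ ^ 2 := fun a => by positivity
  set r := min r₁ r₂ / 2 with hr
  have hr0 : 0 < r := by positivity
  have hb1 : ball z (2 * r) ⊆ ball z r₁ := ball_subset_ball (by
    have := min_le_left r₁ r₂; rw [hr]; linarith)
  have hb2 : ball z (2 * r) ⊆ U := (ball_subset_ball (by
    have := min_le_right r₁ r₂; rw [hr]; linarith)).trans hrU
  have hbr : ball z r ⊆ ball z (2 * r) := ball_subset_ball (by linarith)
  have hsmall : ∀ n, ‖f^[n] z‖ ≤ 2 → ∀ w ∈ ball z (2 * r), ‖f^[n] w‖ ≤ 10 := by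
    intro n hn w hw
    have h1 := (abs_le.1 ((abs_sub_le_dist_stereo _ _).trans (heq n w (hb1 hw)).le)).1
    by_contra! hc
    have h2 : 2 / 5 ≤ 2 / (1 + ‖f^[n] z‖ ^ 2) := by
      gcongr; nlinarith [norm_nonneg (f^[n] z)]
    have h3 : 2 / (1 + ‖f^[n] w‖ ^ 2) ≤ 2 / 101 := by
      gcongr; nlinarith [norm_nonneg (f^[n] z)]
    linarith
  have hlarge : ∀ n, 2 < ‖f^[n] z‖ → ∀ w ∈ ball z (2 * r), 1 ≤ ‖f^[n] w‖ := by
    intro n hn w hw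
    have h1 := (abs_le.1 ((abs_sub_le_dist_stereo _ _).trans (heq n w (hb1 hw)).le)).2
    by_contra! hc
    have h2 : 2 / (1 + ‖f^[n] z‖ ^ 2) ≤ 2 / 5 := by
      gcongr; nlinarith [norm_nonneg (f^[n] z)]
    have h3 : 1 ≤ 2 / (1 + ‖f^[n] w‖ ^ 2) := by
      rw [le_div_iff₀ (hsq _)]; nlinarith [norm_nonneg (f^[n] w)]
    linarith
  refine ⟨r, hr0, fun ε hε => ?_⟩
  set η := ε / (4 * r) with hη
  have hη0 : 0 < η := by positivity
  have hder1 := eventually_norm_deriv_le hdis (F := fun n => f^[n]) (P := fun n => ‖f^[n] z‖ ≤ 2)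
    (z := z) (r := r) (B := 10) hr0 (fun n hn => ⟨(hf.iterate n).differentiableOn,
      fun w hw => ⟨mem_image_of_mem _ (hb2 hw), hsmall n hn w hw⟩⟩) hη0
  have hdis' : Pairwise fun m n => Disjoint ((f^[m] '' U)⁻¹) ((f^[n] '' U)⁻¹) := fun m n hmn => by
    exact Set.disjoint_left.2 fun x hx hx' => Set.disjoint_left.1 (hdis hmn) hx hx'
  have hinvd : ∀ n, 2 < ‖f^[n] z‖ →
      DifferentiableOn ℂ (fun w => (f^[n] w)⁻¹) (ball z (2 * r)) := fun n hn w hw =>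
    ((hf.iterate n) w).fun_inv (norm_pos_iff.1 (one_pos.trans_le (hlarge n hn w hw)))
      |>.differentiableWithinAt
  have hder2 := eventually_norm_deriv_le hdis' (F := fun n w => (f^[n] w)⁻¹)
    (P := fun n => 2 < ‖f^[n] z‖) (z := z) (r := r) (B := 1) hr0
    (fun n hn => ⟨hinvd n hn, fun w hw => ⟨?_, ?_⟩⟩) hη0
  · filter_upwards [hder1, hder2] with n h1 h2 w hw
    have hzb : z ∈ ball z r := mem_ball_self hr0
    have hwz : ‖w - z‖ ≤ r := by rw [← dist_eq_norm]; exact hw.le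
    have hfin : η * r = ε / 4 := by rw [hη]; field_simp
    have hηr : η * ‖w - z‖ ≤ ε / 4 := by
      rw [← hfin]; gcongr
    rcases le_or_gt ‖f^[n] z‖ 2 with hn | hn
    · have h3 := (convex_ball z r).norm_image_sub_le_of_norm_deriv_le
        (fun x _ => (hf.iterate n) x) (h1 hn) hzb hw
      linarith [dist_stereo_le (f^[n] w) (f^[n] z)]
    · have h3 := (convex_ball z r).norm_image_sub_le_of_norm_deriv_le
        (fun x hx => (hinvd n hn).differentiableAt (isOpen_ball.mem_nhds (hbr hx)))
        (h2 hn) hzb hw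
      have hw0 : f^[n] w ≠ 0 := norm_pos_iff.1 (one_pos.trans_le (hlarge n hn w (hbr hw)))
      have hz0 : f^[n] z ≠ 0 := norm_pos_iff.1 (by linarith)
      rw [← dist_stereo_inv hw0 hz0]
      linarith [dist_stereo_le (f^[n] w)⁻¹ (f^[n] z)⁻¹]
  · rw [Set.mem_inv, inv_inv]
    exact mem_image_of_mem _ (hb2 hw)
  · rw [norm_inv]
    exact inv_le_one_of_one_le₀ (hlarge n hn w hw)

theorem iteratesClose_of_isCompact {f : ℂ → ℂ} (hf : Differentiable ℂ f) {U : Set ℂ}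
    (hU : IsOpen U) (hc : IsPreconnected U) (hUF : U ⊆ fatouSet f)
    (hdis : Pairwise fun m n => Disjoint (f^[m] '' U) (f^[n] '' U)) {p : ℂ} (hp : p ∈ U)
    {S : Set ℂ} (hS : IsCompact S) (hSU : S ⊆ U) : IteratesClose f p S := by
  have hpair : ∀ z ∈ U, IteratesClose f p {z} := by
    intro z hz
    refine hc.induction₂ (fun x y => IteratesClose f x {y}) (fun x hx => ?_)
      (fun x y z _ _ _ h1 h2 => h1.trans h2) (fun x y _ _ h => h.symm) hp hz
    obtain ⟨r, hr, hr'⟩ := exists_iteratesClose_ball hf hU hUF hdis hx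
    filter_upwards [mem_nhdsWithin_of_mem_nhds (ball_mem_nhds x hr)] with y hy
    exact hr'.mono (singleton_subset_iff.2 hy)
  refine hS.induction_on ?_ (fun s t hst ht => ht.mono hst) (fun s t hs ht => hs.union ht) ?_
  · exact (hpair p hp).mono (empty_subset _)
  · intro z hz
    obtain ⟨r, hr, hball⟩ := exists_iteratesClose_ball hf hU hUF hdis (hSU hz)
    exact ⟨_, mem_nhdsWithin_of_mem_nhds (ball_mem_nhds z hr), (hpair z (hSU hz)).trans hball⟩

/-- A bounded open set with boundary in a Fatou component but not contained in that component
meets the Julia set. -/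
theorem exists_mem_notMem_fatouSet {f : ℂ → ℂ} {U D : Set ℂ} {u : ℂ}
    (hU : U = connectedComponentIn (fatouSet f) u) (hD : IsOpen D)
    (hb : Bornology.IsBounded D) (hfr : frontier D ⊆ U) (hDU : ¬ D ⊆ U) :
    ∃ z ∈ D, z ∉ fatouSet f := by
  have hUo : IsOpen U := hU ▸ (isOpen_fatouSet f).connectedComponentIn
  have hcomp : IsCompact (closure D ∩ Uᶜ) := hb.isCompact_closure.inter_right hUo.isClosed_compl
  obtain ⟨z₀, hz₀, hz₀U⟩ := not_subset.1 hDU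
  obtain ⟨z, ⟨hz, hzU⟩, hmax⟩ := hcomp.exists_isMaxOn ⟨z₀, subset_closure hz₀, hz₀U⟩
    Complex.continuous_re.continuousOn
  have hzD : z ∈ D := by
    rw [closure_eq_self_union_frontier] at hz
    exact hz.resolve_right fun h => hzU (hfr h)
  refine ⟨z, hzD, fun hzF => hzU ?_⟩
  obtain ⟨r, hr, hrF⟩ := Metric.isOpen_iff.1 ((isOpen_fatouSet f).inter hD) z ⟨hzF, hzD⟩
  have hw : z + ((r / 2 : ℝ) : ℂ) ∈ ball z r := by
    rw [mem_ball, dist_eq_norm, add_sub_cancel_left, Complex.norm_real, Real.norm_eq_abs,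
      abs_of_pos (by positivity)]
    linarith
  have hwU : z + ((r / 2 : ℝ) : ℂ) ∈ U := by
    by_contra hc
    have := hmax ⟨subset_closure (hrF hw).2, hc⟩
    simp only [mem_ofPred_eq, Complex.add_re, Complex.ofReal_re] at this
    linarith
  rw [hU] at hwU ⊢
  rw [connectedComponentIn_eq hwU]
  exact (convex_ball z r).isPreconnected.subset_connectedComponentIn hw
    (fun x hx => (hrF hx).1) (mem_ball_self hr)

theorem isOpenMap_iterate {X : Type*} [TopologicalSpace X] {f : X → X} (ho : IsOpenMap f) (n : ℕ) :
    IsOpenMap f^[n] := by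
  induction n with
  | zero => exact IsOpenMap.id
  | succ n ih => exact ih.comp ho

/-- If the iterates are spherically close on the boundary of `D` to those of `p`, and `D` meets the
Julia set, the images of `D` contain arbitrarily large discs. -/
theorem frequently_ball_subset_image {f : ℂ → ℂ} (hf : Differentiable ℂ f) (ho : IsOpenMap f)
    {D : Set ℂ} (hD : IsOpen D) (hb : Bornology.IsBounded D) {p : ℂ}
    (hclose : IteratesClose f p (frontier D)) {z : ℂ} (hz : z ∈ D) (hzF : z ∉ fatouSet f) (ρ : ℝ) :
    ∃ᶠ n in atTop, ball 0 ρ ⊆ f^[n] '' D := by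
  intro hcon
  apply hzF
  refine ⟨D, hD.mem_nhds hz, fun φ hφ => ?_⟩
  by_cases htend : Tendsto (fun n => ‖f^[φ n] p‖) atTop atTop
  · refine ⟨id, strictMono_id, fun _ => none, fun K hKD _ ε hε => ?_⟩
    set ρ' := max ρ (2 / ε) with hρ'
    have hρ'0 : 0 < ρ' := lt_max_of_lt_right (by positivity)
    obtain ⟨δ, hδ, hδ'⟩ := exists_pos_norm_sub_lt ρ' one_pos
    filter_upwards [hφ.tendsto_atTop.eventually (hclose δ hδ), hφ.tendsto_atTop.eventually hcon,
      htend.eventually_ge_atTop (ρ' + 1)] with n h1 h2 h3 w hw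
    have hfr : ∀ x ∈ frontier D, f^[φ n] x ∉ ball (0 : ℂ) ρ' := by
      intro x hx hx'
      rw [mem_ball_zero_iff] at hx'
      have h4 := hδ' _ _ hx'.le (h1 x hx)
      have h5 := norm_sub_norm_le (f^[φ n] p) (f^[φ n] x)
      rw [norm_sub_rev] at h5
      linarith
    have hwn : ρ' ≤ ‖f^[φ n] w‖ := by
      by_contra! hc
      refine h2 ((ball_subset_ball (le_max_left _ _)).trans
        (subset_image_of_disjoint_frontier (hf.iterate _).continuous (isOpenMap_iterate ho _) hD hb
          (convex_ball 0 ρ').isPreconnected hfr (hKD hw) (mem_ball_zero_iff.2 hc)))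
    simp only [chordalDist, id]
    rw [div_lt_iff₀ (by positivity)]
    have h6 : ρ' < Real.sqrt (1 + ‖f^[φ n] w‖ ^ 2) :=
      Real.lt_sqrt_of_sq_lt (by nlinarith)
    have h7 : 2 / ε ≤ ρ' := le_max_right _ _
    rw [div_le_iff₀ hε] at h7
    nlinarith
  · obtain ⟨X, hX⟩ : ∃ X : ℝ, ∃ᶠ n in atTop, ‖f^[φ n] p‖ ≤ X := by
      rw [Filter.tendsto_atTop] at htend
      push Not at htend
      obtain ⟨X, hX⟩ := htend
      exact ⟨X, hX.mono fun n hn => hn.le⟩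
    obtain ⟨ψ, hψ, hψX⟩ := extraction_of_frequently_atTop hX
    obtain ⟨c, -, χ, hχ, hc⟩ := tendsto_subseq_of_bounded
      (isBounded_closedBall (x := (0 : ℂ)) (r := X)) (x := fun n => f^[φ (ψ n)] p)
      (fun n => by simpa using hψX n)
    refine ⟨ψ ∘ χ, hψ.comp hχ, fun _ => some c, fun K hKD _ ε hε => ?_⟩
    obtain ⟨δ, hδ, hδ'⟩ := exists_pos_norm_sub_lt X (ε := ε / 8) (by positivity)
    have hmono : StrictMono fun n => φ ((ψ ∘ χ) n) := hφ.comp (hψ.comp hχ)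
    filter_upwards [hmono.tendsto_atTop.eventually (hclose δ hδ),
      Metric.tendsto_nhds.1 hc (ε / 8) (by positivity)] with n h1 h2 w hw
    have h3 : ‖f^[φ ((ψ ∘ χ) n)] w - c‖ ≤ ε / 4 := by
      refine Complex.norm_le_of_forall_mem_frontier_norm_le (f := fun w => f^[φ ((ψ ∘ χ) n)] w - c)
        hb ((hf.iterate _).sub_const c).diffContOnCl (fun x hx => ?_) (subset_closure (hKD hw))
      have h4 := h1 x hx
      rw [dist_comm] at h4
      have h5 := hδ' _ _ (hψX (χ n)) h4
      simp only [Function.comp, dist_eq_norm] at h2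
      rw [norm_sub_rev] at h5
      calc _ = ‖(f^[φ ((ψ ∘ χ) n)] x - f^[φ ((ψ ∘ χ) n)] p) + (f^[φ ((ψ ∘ χ) n)] p - c)‖ := by
            rw [sub_add_sub_cancel]
        _ ≤ _ := norm_add_le _ _
        _ ≤ ε / 8 + ε / 8 := add_le_add h5.le h2.le
        _ = ε / 4 := by ring
    rw [← dist_stereo]
    linarith [dist_stereo_le (f^[φ ((ψ ∘ χ) n)] w) c]

theorem tendsto_norm_iterate_atTop {f : ℂ → ℂ} (hf : Differentiable ℂ f) (ho : IsOpenMap f)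
    {D : Set ℂ} (hD : IsOpen D) (hb : Bornology.IsBounded D) {p : ℂ}
    (hclose : IteratesClose f p (frontier D)) {z : ℂ} (hz : z ∈ D) (hzF : z ∉ fatouSet f) :
    Tendsto (fun n => ‖f^[n] p‖) atTop atTop := by
  by_contra htend
  obtain ⟨X, hX⟩ : ∃ X : ℝ, ∃ᶠ n in atTop, ‖f^[n] p‖ ≤ X := by
    rw [Filter.tendsto_atTop] at htend
    push Not at htend
    obtain ⟨X, hX⟩ := htend
    exact ⟨X, hX.mono fun n hn => hn.le⟩
  obtain ⟨T, hT⟩ := hb.subset_ball 0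
  obtain ⟨m, hmT, hm⟩ := ((frequently_ball_subset_image hf ho hD hb hclose hz hzF T).and_eventually
    (eventually_ge_atTop 1)).exists
  have hDm : D ⊆ f^[m] '' D := hT.trans hmT
  have hDk : ∀ k, D ⊆ f^[m * k] '' D := by
    intro k
    induction k with
    | zero => simp
    | succ k ih =>
      rw [Nat.mul_succ, Function.iterate_add, image_comp]
      exact ih.trans (image_mono hDm)
  obtain ⟨η, hη, hηj⟩ := exists_pos_forall_lt
    (P := fun j s => ∀ c : ℂ, ¬ f^[j] '' D ⊆ closedBall c s)
    (fun n s t hst h c hc => h c (hc.trans (closedBall_subset_closedBall hst))) (fun j => by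
      obtain ⟨s, hs, hsb⟩ := Metric.isOpen_iff.1 ((isOpenMap_iterate ho j) D hD) _ (mem_image_of_mem _ hz)
      refine ⟨s / 5, by positivity, fun c hc => ?_⟩
      have h1 := hc (hsb (mem_ball_self hs))
      have h2 : f^[j] z + ((s / 2 : ℝ) : ℂ) ∈ ball (f^[j] z) s := by
        rw [mem_ball, dist_eq_norm, add_sub_cancel_left, Complex.norm_real, Real.norm_eq_abs,
          abs_of_pos (by positivity)]
        linarith
      have h3 := hc (hsb h2)
      have h4 := dist_triangle_right (f^[j] z + ((s / 2 : ℝ) : ℂ)) (f^[j] z) c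
      rw [dist_eq_norm _ (f^[j] z), add_sub_cancel_left, Complex.norm_real, Real.norm_eq_abs,
          abs_of_pos (by positivity)] at h4
      rw [mem_closedBall] at h1 h3
      linarith) m
  obtain ⟨δ, hδ, hδ'⟩ := exists_pos_norm_sub_lt X hη
  obtain ⟨n, hnX, hn⟩ := (hX.and_eventually (hclose δ hδ)).exists
  refine hηj (n % m) (Nat.mod_lt _ hm) (f^[n] p) ?_
  have h1 : f^[n % m] '' D ⊆ f^[n] '' D := by
    conv_rhs => rw [← Nat.mod_add_div n m]
    rw [Function.iterate_add, image_comp]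
    exact image_mono (hDk _)
  refine h1.trans ?_
  rintro _ ⟨w, hw, rfl⟩
  rw [mem_closedBall, dist_eq_norm]
  refine Complex.norm_le_of_forall_mem_frontier_norm_le (f := fun w => f^[n] w - f^[n] p)
    hb ((hf.iterate _).sub_const _).diffContOnCl (fun x hx => ?_) (subset_closure hw)
  have h4 := hn x hx
  rw [dist_comm] at h4
  have := hδ' _ _ hnX h4
  rw [norm_sub_rev] at this
  exact this.le

theorem IteratesClose.eventually_le_norm {f : ℂ → ℂ} {p : ℂ} {S : Set ℂ}
    (h : IteratesClose f p S) (hp : Tendsto (fun n => ‖f^[n] p‖) atTop atTop) (ρ : ℝ) :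
    ∀ᶠ n in atTop, ∀ w ∈ S, ρ ≤ ‖f^[n] w‖ := by
  obtain ⟨δ, hδ, hδ'⟩ := exists_pos_norm_sub_lt ρ one_pos
  filter_upwards [h δ hδ, hp.eventually_ge_atTop (ρ + 1)] with n h1 h2 w hw
  by_contra! hc
  have h3 := hδ' _ _ hc.le (h1 w hw)
  have h4 := norm_sub_norm_le (f^[n] p) (f^[n] w)
  rw [norm_sub_rev] at h4
  linarith

theorem eventually_ball_subset_image {f : ℂ → ℂ} (hf : Differentiable ℂ f) (ho : IsOpenMap f)
    {D : Set ℂ} (hD : IsOpen D) (hb : Bornology.IsBounded D)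
    (hesc : ∀ ρ : ℝ, ∀ᶠ n in atTop, ∀ w ∈ frontier D, ρ ≤ ‖f^[n] w‖)
    (hfreq : ∀ ρ : ℝ, ∃ᶠ n in atTop, ball 0 ρ ⊆ f^[n] '' D) (ρ : ℝ) :
    ∀ᶠ n in atTop, ball 0 ρ ⊆ f^[n] '' D := by
  set ρ₁ := max (‖f 0‖ + 1) ρ with hρ₁
  have h0 : ‖f 0‖ < ρ₁ := (lt_add_one _).trans_le (le_max_left _ _)
  have hρ₁0 : 0 < ρ₁ := (norm_nonneg _).trans_lt h0
  obtain ⟨N, hN⟩ := eventually_atTop.1 (hesc ρ₁)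
  obtain ⟨m, hm, hmN⟩ := ((hfreq ρ₁).and_eventually (eventually_ge_atTop N)).exists
  have hall : ∀ n ≥ m, ball 0 ρ₁ ⊆ f^[n] '' D := by
    intro n hn
    induction n, hn using Nat.le_induction with
    | base => exact hm
    | succ n hn ih =>
      obtain ⟨z, hz, hz0⟩ := ih (mem_ball_self hρ₁0)
      refine subset_image_of_disjoint_frontier (hf.iterate _).continuous (isOpenMap_iterate ho _) hD hb
          (convex_ball 0 ρ₁).isPreconnected (fun x hx hx' => ?_) hz ?_
      · have := hN (n + 1) (by omega) x hx
        rw [mem_ball_zero_iff] at hx'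
        linarith
      · rw [Function.iterate_succ_apply', hz0]
        simpa using h0
  filter_upwards [eventually_ge_atTop m] with n hn
  exact (ball_subset_ball (le_max_right _ _)).trans (hall n hn)

/-- Along a sequence of iterates for which the modulus is comparable on the boundary of `D`, the
iterates are relatively small near some boundary point. -/
theorem exists_mem_frontier_iterate_small {f : ℂ → ℂ} (hf : TranscendentalEntire f)
    {D : Set ℂ} (hD : IsOpen D) (hb : Bornology.IsBounded D)
    (hesc : ∀ ρ : ℝ, ∀ᶠ n in atTop, ∀ w ∈ frontier D, ρ ≤ ‖f^[n] w‖)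
    (hcov : ∀ ρ : ℝ, ∀ᶠ n in atTop, ball 0 ρ ⊆ f^[n] '' D) {l : Filter ℕ} (hl : l ≤ atTop)
    {M : ℕ → ℝ} (hM : Tendsto M l atTop) {C : ℝ}
    (hC : ∀ᶠ n in l, ∀ z ∈ frontier D, ‖f^[n] z‖ ≤ C * M n) :
    ∃ p ∈ frontier D, ∀ V ∈ 𝓝 p, ∃ z ∈ V, ∀ ε > 0, ∀ᶠ n in l, ‖f^[n] z‖ ≤ ε * M n := by
  obtain ⟨T', hT'⟩ := hb.subset_ball 0
  set T := max T' 1 with hT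
  have hT0 : 0 < T := by positivity
  have hDT : D ⊆ ball 0 T := hT'.trans (ball_subset_ball (le_max_left _ _))
  obtain ⟨m, hm1, hm2⟩ := ((hesc (8 * T)).and (hcov (2 * T))).exists
  set W := D ∩ f^[m] ⁻¹' ball 0 (2 * T) with hW
  have hd := fun n => hf.1.iterate n
  refine exists_mem_frontier_small hd hD hb (hM.eventually_gt_atTop 0) hC (W := W)
    (hD.inter (isOpen_ball.preimage (hd m).continuous)) ?_ inter_subset_left ?_
  · obtain ⟨z, hz, hz0⟩ := hm2 (mem_ball_self (by positivity : 0 < 2 * T))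
    exact ⟨z, hz, by rw [mem_preimage, hz0]; exact mem_ball_self (by positivity)⟩
  · intro ε hε
    obtain ⟨k, hk⟩ := exists_pow_lt_of_lt_one (y := (3 / 7 : ℝ)) (x := ε / (2 * (|C| + 1)))
      (by positivity) (by norm_num)
    obtain ⟨R, B', -, -, ⟨a, ha⟩, hB'⟩ := hf.exists_card_fiber isOpen_univ univ_nonempty k
    obtain ⟨s, hsk, hs⟩ := hB' a ha
    obtain ⟨N, hN⟩ := eventually_atTop.1 (hcov (R + 1))
    filter_upwards [hC, hl (eventually_ge_atTop (m + N + 1)), hM.eventually_ge_atTop 0,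
      hM.eventually_ge_atTop (4 * ‖a‖ / ε)] with n h1 h2 h3 h4 z hz
    obtain ⟨i, rfl, hi⟩ : ∃ i, n = i + 1 + m ∧ N ≤ i := ⟨n - m - 1, by omega, by omega⟩
    have hpre : ∀ q ∈ s, ∃ x ∈ D, f^[i] x = q := fun q hq => by
      refine hN i hi ?_
      rw [mem_ball_zero_iff]
      linarith [(hs q hq).1]
    choose! v hvD hv using hpre
    have hinj : Set.InjOn v s := fun x hx y hy hxy => by
      rw [← hv x hx, ← hv y hy, hxy]
    have hit : ∀ w, f^[i + 1 + m] w = f^[i + 1] (f^[m] w) := fun w =>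
      Function.iterate_add_apply f (i + 1) m w
    have h5 := norm_comp_le_of_zeros (g := fun w => f^[i + 1] w - a) (h := f^[m])
      ((hd (i + 1)).sub_const a) (hd m) hb (T := T) (A := |C| * M (i + 1 + m) + ‖a‖) hT0
      (by positivity) (s := s.image v) ?_ ?_ hz.1 (mem_ball_zero_iff.1 hz.2)
    · rw [Finset.card_image_of_injOn hinj, hsk, ← hit] at h5
      rw [lt_div_iff₀ (by positivity)] at hk
      rw [div_le_iff₀ hε] at h4
      have h6 : (3 / 7 : ℝ) ^ k ≤ 1 := pow_le_one₀ (by norm_num) (by norm_num)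
      have h7 : 0 < (3 / 7 : ℝ) ^ k := by positivity
      have h8 : ‖f^[i + 1 + m] z‖ ≤ ‖f^[i + 1 + m] z - a‖ + ‖a‖ := by
        simpa using norm_add_le (f^[i + 1 + m] z - a) a
      have h9 : ‖a‖ * (3 / 7 : ℝ) ^ k ≤ ‖a‖ := mul_le_of_le_one_right (norm_nonneg a) h6
      have h10 : |C| * M (i + 1 + m) * (3 / 7) ^ k ≤ ε / 2 * M (i + 1 + m) := by
        have : |C| * (3 / 7) ^ k ≤ ε / 2 := by nlinarith
        nlinarith [mul_le_mul_of_nonneg_right this h3]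
      nlinarith
    · intro q hq
      obtain ⟨x, hx, rfl⟩ := Finset.mem_image.1 hq
      refine ⟨mem_ball_zero_iff.1 (hDT (hvD x hx)), ?_⟩
      rw [Function.iterate_succ_apply', hv x hx, (hs x hx).2, sub_self]
    · intro x hx
      refine ⟨hm1 x hx, ?_⟩
      rw [← hit]
      refine (norm_sub_le _ _).trans ?_
      gcongr
      refine (h1 x hx).trans ?_
      gcongr
      exact le_abs_self C

/-- If `U` is a wandering domain surrounding points of the Julia set, the maximum of the logarithmic
derivative of the iterates over some compact subset of `U` tends to infinity. -/
theorem exists_isCompact_forall_exists_lt_deriv {f : ℂ → ℂ} (hf : TranscendentalEntire f)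
    {U : Set ℂ} (hU : IsOpen U) (hc : IsPreconnected U) (hUF : U ⊆ fatouSet f)
    (hdis : Pairwise fun m n => Disjoint (f^[m] '' U) (f^[n] '' U)) {D : Set ℂ} (hD : IsOpen D)
    (hb : Bornology.IsBounded D) (hfr : frontier D ⊆ U) {z : ℂ} (hz : z ∈ D)
    (hzF : z ∉ fatouSet f) {p : ℂ} (hp : p ∈ U) :
    ∃ K ⊆ U, IsCompact K ∧
      ∀ C : ℝ, ∀ᶠ n in atTop, ∃ w ∈ K, C * ‖f^[n] w‖ < ‖deriv f^[n] w‖ := by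
  have hcomp : IsCompact (frontier D) := hb.isCompact_closure.of_isClosed_subset isClosed_frontier
    frontier_subset_closure
  have hclose : IteratesClose f p (frontier D) :=
    iteratesClose_of_isCompact hf.1 hU hc hUF hdis hp hcomp hfr
  have htend := tendsto_norm_iterate_atTop hf.1 hf.isOpenMap hD hb hclose hz hzF
  have hesc := fun ρ => hclose.eventually_le_norm htend ρ
  have hcov := fun ρ => eventually_ball_subset_image hf.1 hf.isOpenMap hD hb hesc
    (fun ρ => frequently_ball_subset_image hf.1 hf.isOpenMap hD hb hclose hz hzF ρ) ρ
  obtain ⟨δ, hδ, hδU⟩ := hcomp.exists_cthickening_subset_open hU hfr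
  obtain ⟨K, hKU, hK, hKC⟩ := harnackBound_of_isCompact hU hc hp hcomp.cthickening hδU
  refine ⟨K, hKU, hK, fun C => ?_⟩
  by_contra hcon
  obtain ⟨C', hC'0, hC'⟩ := hKC C
  set l := atTop ⊓ 𝓟 {n : ℕ | ¬ ∃ w ∈ K, C * ‖f^[n] w‖ < ‖deriv f^[n] w‖} with hl
  have : l.NeBot := frequently_mem_iff_neBot.1 (not_eventually.1 hcon)
  have hall : ∀ᶠ n in l, ∀ x ∈ cthickening δ (frontier D),
      ‖f^[n] p‖ ≤ C' * ‖f^[n] x‖ ∧ ‖f^[n] x‖ ≤ C' * ‖f^[n] p‖ := by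
    filter_upwards [mem_inf_of_right (mem_principal_self _)] with n hn x hx
    refine hC' _ (hf.1.iterate n).differentiableOn (fun w hw => ?_) x hx
    by_contra! h
    exact hn ⟨w, hw, h⟩
  obtain ⟨q, hq, hqV⟩ := exists_mem_frontier_iterate_small hf hD hb hesc hcov
    (inf_le_left : l ≤ atTop) (htend.mono_left inf_le_left) (hall.mono fun n hn x hx =>
      (hn x (self_subset_cthickening _ hx)).2)
  obtain ⟨x, hx, hxs⟩ := hqV (thickening δ (frontier D))
    (isOpen_thickening.mem_nhds (self_subset_thickening hδ _ hq))
  obtain ⟨n, h1, h2, h3⟩ := ((hxs (1 / (2 * (C' + 1))) (by positivity)).and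
    (hall.and ((htend.mono_left (inf_le_left : l ≤ atTop)).eventually_gt_atTop 0))).exists
  have h4 := (h2 x (thickening_subset_cthickening _ _ hx)).1
  have h5 : (C' + 1) * ‖f^[n] x‖ ≤ ‖f^[n] p‖ / 2 := by
    calc _ ≤ (C' + 1) * (1 / (2 * (C' + 1)) * ‖f^[n] p‖) := by gcongr
      _ = _ := by field_simp
  nlinarith [norm_nonneg (f^[n] x)]

/-- The images of a multiply connected wandering domain eventually contain arbitrarily thick annuli
of arbitrarily large inner radius. -/
theorem eventually_exists_annulus_subset {f : ℂ → ℂ} (hf : TranscendentalEntire f)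
    {U : Set ℂ} (hU : IsOpen U) (hc : IsPreconnected U) (hUF : U ⊆ fatouSet f)
    (hdis : Pairwise fun m n => Disjoint (f^[m] '' U) (f^[n] '' U)) {D : Set ℂ} (hD : IsOpen D)
    (hb : Bornology.IsBounded D) (hfr : frontier D ⊆ U) {z : ℂ} (hz : z ∈ D)
    (hzF : z ∉ fatouSet f) {p : ℂ} (hp : p ∈ U) (k : ℝ) :
    ∀ᶠ n in atTop, ∃ r R : ℝ, 0 < r ∧ k ≤ r ∧ r ≤ R ∧ k * r ≤ R ∧
      {w : ℂ | r ≤ ‖w‖ ∧ ‖w‖ ≤ R} ⊆ f^[n] '' U := by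
  obtain ⟨K, hKU, hK, hKC⟩ :=
    exists_isCompact_forall_exists_lt_deriv hf hU hc hUF hdis hD hb hfr hz hzF hp
  obtain ⟨δ', hδ', hδU⟩ := hK.exists_cthickening_subset_open hU hKU
  have hcomp : IsCompact (frontier D) := hb.isCompact_closure.of_isClosed_subset isClosed_frontier
    frontier_subset_closure
  have htend := tendsto_norm_iterate_atTop hf.1 hf.isOpenMap hD hb
    (iteratesClose_of_isCompact hf.1 hU hc hUF hdis hp hcomp hfr) hz hzF
  have hesc := (iteratesClose_of_isCompact hf.1 hU hc hUF hdis hp hK.cthickening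
    hδU).eventually_le_norm htend (max k 1)
  set t := Real.log (max k 1) with ht
  filter_upwards [hesc, hKC ((t + 5) * 48 / (δ' / 2))] with n h1 ⟨w, hw, hwn⟩
  have hwt : ∀ x ∈ ball w δ', x ∈ cthickening δ' K := fun x hx =>
    thickening_subset_cthickening _ _ (mem_thickening_iff.2 ⟨w, hw, hx⟩)
  have hne : ∀ x ∈ ball w δ', f^[n] x ≠ 0 := fun x hx h0 => by
    have := h1 x (hwt x hx)
    rw [h0, norm_zero] at this
    linarith [le_max_right k 1]
  obtain ⟨z₁, hz₁, himg⟩ := mem_image_of_abs_log_sub_lt (half_pos hδ') (half_lt_self hδ')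
    (hf.1.iterate n).differentiableOn hne
  have hsub : closedBall w (δ' / 2) ⊆ ball w δ' := closedBall_subset_ball (half_lt_self hδ')
  have hr := h1 z₁ (hwt z₁ (hsub hz₁))
  have hr0 : 0 < ‖f^[n] z₁‖ := by linarith [le_max_right k 1]
  have hk1 : (1 : ℝ) ≤ max k 1 := le_max_right _ _
  have ht0 : 0 ≤ t := Real.log_nonneg hk1
  refine ⟨‖f^[n] z₁‖, max k 1 * ‖f^[n] z₁‖, hr0, (le_max_left _ _).trans hr,
    le_mul_of_one_le_left hr0.le hk1, mul_le_mul_of_nonneg_right (le_max_left _ _) hr0.le, ?_⟩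
  rintro x ⟨hx1, hx2⟩
  have hx0 : 0 < ‖x‖ := hr0.trans_le hx1
  refine image_mono (fun y hy => hδU (hwt y (hsub hy))) (himg x (norm_pos_iff.1 hx0) ?_)
  have h2 := Real.log_le_log hr0 hx1
  have h3 := Real.log_le_log hx0 hx2
  rw [Real.log_mul (by positivity) hr0.ne'] at h3
  rw [abs_of_nonneg (by linarith)]
  have hw0 : 0 < ‖f^[n] w‖ := norm_pos_iff.2 (hne w (mem_ball_self hδ'))
  rw [← lt_div_iff₀ hw0] at hwn
  rw [div_lt_iff₀ (half_pos hδ')] at hwn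
  linarith

theorem exists_tendsto_eventually_of_forall_eventually {P : ℕ → ℕ → Prop}
    (h : ∀ k, ∀ᶠ n in atTop, P k n) :
    ∃ κ : ℕ → ℕ, Tendsto κ atTop atTop ∧ ∀ᶠ n in atTop, P (κ n) n := by
  classical
  refine ⟨fun n => Nat.findGreatest (fun k => P k n) n, Filter.tendsto_atTop.2 fun k => ?_, ?_⟩
  · filter_upwards [h k, eventually_ge_atTop k] with n h1 h2 using Nat.le_findGreatest h2 h1
  · filter_upwards [h 0] with n hn using Nat.findGreatest_spec (P := fun k => P k n) n.zero_le hn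

theorem forall_norm_lt_or_forall_lt_norm {E : Type*} [SeminormedAddCommGroup E] {S : Set E}
    (hS : IsPreconnected S) {r R : ℝ} (hrR : r ≤ R) (h : Disjoint {z : E | r ≤ ‖z‖ ∧ ‖z‖ ≤ R} S) :
    (∀ z ∈ S, ‖z‖ < r) ∨ ∀ z ∈ S, R < ‖z‖ := by
  by_contra! hcon
  obtain ⟨⟨x, hx, hxr⟩, y, hy, hyR⟩ := hcon
  rcases le_total ‖x‖ R with hxR | hxR
  · exact disjoint_left.1 h ⟨hxr, hxR⟩ hx
  · obtain ⟨z, hz, rfl⟩ := (hS.image _ continuous_norm.continuousOn).ordConnected.out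
      (mem_image_of_mem _ hy) (mem_image_of_mem _ hx) ⟨hyR, hxR⟩
    exact disjoint_left.1 h ⟨hrR, le_rfl⟩ hz

theorem pairwise_disjoint_iterate_image {f : ℂ → ℂ} (hf : Continuous f) (ho : IsOpenMap f)
    {U : Set ℂ} (hc : IsPreconnected U) (hUF : U ⊆ fatouSet f) {u : ℂ} (hu : u ∈ U)
    (hw : ∀ m n : ℕ, m ≠ n → connectedComponentIn (fatouSet f) (f^[m] u) ≠
      connectedComponentIn (fatouSet f) (f^[n] u)) :
    Pairwise fun m n => Disjoint (f^[m] '' U) (f^[n] '' U) := by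
  have hsub : ∀ n, f^[n] '' U ⊆ connectedComponentIn (fatouSet f) (f^[n] u) := fun n =>
    (hc.image _ (hf.iterate n).continuousOn).subset_connectedComponentIn (mem_image_of_mem _ hu)
      (image_subset_iff.2 fun x hx => (mapsTo_fatouSet ho).iterate n (hUF hx))
  refine fun m n hmn => disjoint_left.2 fun w h1 h2 => hw m n hmn ?_
  rw [connectedComponentIn_eq (hsub m h1), connectedComponentIn_eq (hsub n h2)]

theorem multiply_connected_wandering_domain_annuli
    (f : ℂ → ℂ) (hf : TranscendentalEntire f) (U : Set ℂ)
    (hU : IsMultiplyConnectedWanderingDomain f U) :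
    ∃ r R : ℕ → ℝ, (∀ n : ℕ, 0 < r n ∧ 0 < R n) ∧
      Tendsto r atTop atTop ∧ Tendsto (fun n => R n / r n) atTop atTop ∧
      ∀ᶠ n in atTop,
        {z : ℂ | r n ≤ ‖z‖ ∧ ‖z‖ ≤ R n} ⊆ f^[n] '' U ∧
        f^[n] '' U ⊆ {z : ℂ | R (n - 1) ≤ ‖z‖ ∧ ‖z‖ ≤ r (n + 1)} := by
  obtain ⟨⟨u, huF, hUu⟩, hw, hsc⟩ := hU
  have hu : u ∈ U := hUu ▸ mem_connectedComponentIn huF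
  have hUo : IsOpen U := hUu ▸ (isOpen_fatouSet f).connectedComponentIn
  have hUc : IsPreconnected U := hUu ▸ isPreconnected_connectedComponentIn
  have hUF : U ⊆ fatouSet f := hUu ▸ connectedComponentIn_subset _ _
  have hdis := pairwise_disjoint_iterate_image hf.1.continuous hf.isOpenMap hUc hUF hu
    fun m n hmn => hw m n hmn u hu
  obtain ⟨D, hD, hb, hfr, hDU⟩ : ∃ D, IsOpen D ∧ Bornology.IsBounded D ∧ frontier D ⊆ U ∧
      ¬ D ⊆ U := by
    by_contra! h
    exact hsc (simplyConnectedSpace_of_frontier_subset hUo ⟨⟨u, hu⟩, hUc⟩ h)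
  obtain ⟨z, hz, hzF⟩ := exists_mem_notMem_fatouSet hUu hD hb hfr hDU
  obtain ⟨κ, hκ, hκP⟩ := exists_tendsto_eventually_of_forall_eventually fun k : ℕ =>
    eventually_exists_annulus_subset hf hUo hUc hUF hdis hD hb hfr hz hzF hu k
  have hex : ∀ n, ∃ r R : ℝ, (0 < r ∧ 0 < R) ∧ ((∃ r R : ℝ, 0 < r ∧ κ n ≤ r ∧ r ≤ R ∧
      κ n * r ≤ R ∧ {w : ℂ | r ≤ ‖w‖ ∧ ‖w‖ ≤ R} ⊆ f^[n] '' U) → κ n ≤ r ∧ r ≤ R ∧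
      κ n * r ≤ R ∧ {w : ℂ | r ≤ ‖w‖ ∧ ‖w‖ ≤ R} ⊆ f^[n] '' U) := by
    intro n
    by_cases h : ∃ r R : ℝ, 0 < r ∧ κ n ≤ r ∧ r ≤ R ∧
      κ n * r ≤ R ∧ {w : ℂ | r ≤ ‖w‖ ∧ ‖w‖ ≤ R} ⊆ f^[n] '' U
    · obtain ⟨r, R, hr, h1, h2, h3⟩ := h
      exact ⟨r, R, ⟨hr, hr.trans_le h2⟩, fun _ => ⟨h1, h2, h3⟩⟩
    · exact ⟨1, 1, ⟨one_pos, one_pos⟩, fun h' => absurd h' h⟩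
  choose r R hpos hrR using hex
  have hrR' := hκP.mono fun n hn => hrR n hn
  have hκ' : Tendsto (fun n => (κ n : ℝ)) atTop atTop := tendsto_natCast_atTop_atTop.comp hκ
  have hr : Tendsto r atTop atTop := tendsto_atTop_mono' _ (hrR'.mono fun n hn => hn.1) hκ'
  refine ⟨r, R, hpos, hr, tendsto_atTop_mono' _ (hrR'.mono fun n hn => ?_) hκ', ?_⟩
  · rw [le_div_iff₀ (hpos n).1]
    exact hn.2.2.1
  have hcirc : ∀ n, ((r n : ℝ) : ℂ) ∈ {w : ℂ | r n ≤ ‖w‖ ∧ ‖w‖ ≤ r n} := fun n => by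
    simp [abs_of_pos (hpos n).1]
  have hconn : ∀ n, IsPreconnected (f^[n] '' U) := fun n =>
    hUc.image _ (hf.1.continuous.iterate n).continuousOn
  have hout : ∀ᶠ n in atTop, ∀ w ∈ f^[n + 1] '' U, R n < ‖w‖ := by
    filter_upwards [hrR', hr.eventually hf.exists_norm_eq_le] with n h1 h2
    refine (forall_norm_lt_or_forall_lt_norm (hconn (n + 1)) h1.2.1
      ((hdis n.succ_ne_self.symm).mono_left h1.2.2.2)).resolve_left fun h3 => ?_
    obtain ⟨x, hx, hfx⟩ := h2
    obtain ⟨y, hy, rfl⟩ := h1.2.2.2 ⟨hx.ge, hx.trans_le h1.2.1⟩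
    rw [← Function.iterate_succ_apply' f] at hfx
    exact (h3 _ (mem_image_of_mem _ hy)).not_ge hfx
  filter_upwards [hrR', (tendsto_add_atTop_nat 1).eventually hrR', hout,
    (tendsto_sub_atTop_nat 1).eventually hout, eventually_ge_atTop 1] with n h1 h2 h3 h4 hn
  rw [Nat.sub_add_cancel hn] at h4
  have hmem : ∀ {m}, r m ≤ R m → {w : ℂ | r m ≤ ‖w‖ ∧ ‖w‖ ≤ R m} ⊆ f^[m] '' U →
      ((r m : ℝ) : ℂ) ∈ f^[m] '' U := fun {m} h h' =>
    h' ⟨(hcirc m).1, (hcirc m).2.trans h⟩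
  refine ⟨h1.2.2.2, fun w hw => ⟨(h4 w hw).le, ?_⟩⟩
  rcases forall_norm_lt_or_forall_lt_norm (hconn n) h2.2.1
      ((hdis n.succ_ne_self).mono_left h2.2.2.2) with h5 | h5
  · exact (h5 w hw).le
  · have h6 := h5 _ (hmem h1.2.1 h1.2.2.2)
    have h7 := h3 _ (hmem h2.2.1 h2.2.2.2)
    linarith [(hcirc n).2, (hcirc (n + 1)).2, h1.2.1, h2.2.1]
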